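/- Let A be a function on ℝ with A' ∈ BMO(ℝ), and let q_1,…,q_{m+1} ∈ [1,∞). Suppose that for some β ∈ [0,∞) the operator C_{m+1,A} satisfies |{x ∈ ℝ : |C_{m+1,A}(a_1,…,a_m; f)(x)| > 1}| ≤ C ( Σ_{j=1}^m ‖a_j‖_{L^{q_j}(ℝ)}^{q_j} + ∫_ℝ |f(x)|^{q_{m+1}} log^β(e + |f(x)|) dx ) for all a_1,…,a_m, f. Then for any p_1 ∈ [1,q_1),…, p_m ∈ [1,q_m), one has |{x ∈ ℝ : |C_{m+1,A}(a_1,…,a_m; f)(x)| > 1}| ≤ C' ( Σ_{j=1}^m ‖a_j‖_{L^{p_j}(ℝ)}^{p_j} + ∫_ℝ |f(x)|^{q_{m+1}} log^{β_{q_{m+1}}}(e + |f(x)|) dx ), where β_{q_{m+1}} = β if q_{m+1} ∈ (1,∞) and β_{q_{m+1}} = max{1, β} if q_{m+1} = 1. -/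

import Mathlib

open MeasureTheory Filter Set
open scoped ENNReal BigOperators

noncomputable section

/-- `Adiff g x y = ∫_y^x g`, i.e. `G x - G y` for an antiderivative `G` of `g`. -/
def Adiff (g : ℝ → ℝ) (x y : ℝ) : ℝ := ∫ t in y..x, g t

/-- `P₂(A; x, y) = A x - A y - A' y * (x - y)`. -/
def P2 (A A' : ℝ → ℝ) (x y : ℝ) : ℝ := A x - A y - A' y * (x - y)

/-- The generalized Calderón commutator `𝒞_{m+1,A}(a₁,…,a_m; f)`, defined as a
principal value. -/
def CcommA (m : ℕ) (A A' : ℝ → ℝ) (a : Fin m → ℝ → ℝ) (f : ℝ → ℝ) (x : ℝ) : ℝ :=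
  limUnder (nhdsWithin 0 (Ioi 0)) fun ε : ℝ =>
    ∫ y in {y : ℝ | ε < |x - y|},
      (P2 A A' x y * ∏ j, Adiff (a j) x y) / (x - y) ^ (m + 2) * f y

/-- The `(m+1)`-th order Calderón commutator `𝒞_{m+1}(a₁,…,a_m; f)`. -/
def Ccomm (m : ℕ) (a : Fin m → ℝ → ℝ) (f : ℝ → ℝ) (x : ℝ) : ℝ :=
  limUnder (nhdsWithin 0 (Ioi 0)) fun ε : ℝ =>
    ∫ y in {y : ℝ | ε < |x - y|},
      (∏ j, Adiff (a j) x y) / (x - y) ^ (m + 1) * f y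

/-- The BMO norm of `g` over intervals in `ℝ`. -/
def bmoNorm (g : ℝ → ℝ) : ℝ :=
  sSup {c : ℝ | ∃ u v : ℝ, u < v ∧
    c = (v - u)⁻¹ * ∫ y in Ioc u v, |g y - (v - u)⁻¹ * ∫ z in Ioc u v, g z|}

/-- Average (in `ℝ≥0∞`) of a nonnegative function over an interval. -/
def avgE (g : ℝ → ℝ) (u v : ℝ) : ℝ≥0∞ :=
  (ENNReal.ofReal (v - u))⁻¹ * ∫⁻ y in Ioc u v, ENNReal.ofReal (g y)

/-- Weighted `L^p` norm `(∫ |g|^p w)^{1/p}`. -/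
def wLpNorm (p : ℝ) (w g : ℝ → ℝ) : ℝ≥0∞ :=
  (∫⁻ x, ENNReal.ofReal (|g x| ^ p * w x)) ^ (1 / p)

/-- `L^p` norm. -/
def LpNorm (p : ℝ) (g : ℝ → ℝ) : ℝ≥0∞ :=
  (∫⁻ x, ENNReal.ofReal (|g x| ^ p)) ^ (1 / p)

/-- Weak `L^p` quasinorm. -/
def wkNorm (p : ℝ) (g : ℝ → ℝ) : ℝ≥0∞ :=
  ⨆ (t : ℝ) (_ : 0 < t), ENNReal.ofReal t * (volume {x : ℝ | t < |g x|}) ^ (1 / p)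

/-- The multiple weight `ν_{→w} = ∏ w_i^{p/p_i}`. -/
def nuW (k : ℕ) (ptot : ℝ) (p : Fin k → ℝ) (w : Fin k → ℝ → ℝ) : ℝ → ℝ :=
  fun x => ∏ i, w i x ^ (ptot / p i)

/-- The multilinear Muckenhoupt `A_{→P}` constant (for exponents `p i > 1`). -/
def APconst (k : ℕ) (ptot : ℝ) (p : Fin k → ℝ) (w : Fin k → ℝ → ℝ) : ℝ≥0∞ :=
  ⨆ (u : ℝ) (v : ℝ) (_ : u < v),
    avgE (nuW k ptot p w) u v *
      ∏ i, (avgE (fun y => w i y ^ (-(1 / (p i - 1)))) u v) ^ (ptot * (1 - 1 / p i))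

/-- Hardy–Littlewood maximal operator on `ℝ` (over intervals). -/
def Mop1 (g : ℝ → ℝ) (x : ℝ) : ℝ≥0∞ :=
  ⨆ (u : ℝ) (v : ℝ) (_ : u < v) (_ : x ∈ Ioc u v), avgE (fun y => |g y|) u v

/-- The Fujii–Wilson `A_∞` constant of a weight `u` on `ℝ`. -/
def AinfConst (u : ℝ → ℝ) : ℝ≥0∞ :=
  ⨆ (c : ℝ) (d : ℝ) (_ : c < d),
    (∫⁻ y in Ioc c d, ENNReal.ofReal (u y))⁻¹ *
      ∫⁻ x in Ioc c d, Mop1 (Set.indicator (Ioc c d) u) x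

/-- The `A_{(1,…,1)}` constant of a vector weight. -/
def A11const (k : ℕ) (w : Fin k → ℝ → ℝ) : ℝ≥0∞ :=
  ⨆ (u : ℝ) (v : ℝ) (_ : u < v),
    avgE (fun x => ∏ i, w i x ^ ((1 : ℝ) / k)) u v *
      ∏ i, ((ENNReal.ofReal (essInf (w i) (volume.restrict (Ioc u v))))⁻¹) ^ ((1 : ℝ) / k)

/-- Luxemburg norm `‖f‖_{L(log L)^γ, (u,v)}` over the interval `(u, v]`. -/
def luxNormI (γ : ℝ) (u v : ℝ) (f : ℝ → ℝ) : ℝ :=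
  sInf {t : ℝ | 0 < t ∧
    ∫⁻ y in Ioc u v, ENNReal.ofReal (|f y| / t * Real.log (Real.exp 1 + |f y| / t) ^ γ)
      ≤ ENNReal.ofReal (v - u)}

/-- The interval with the same center as `(u,v]` and `lam` times its length. -/
def scaleI (lam u v : ℝ) : ℝ × ℝ :=
  ((u + v) / 2 - lam * (v - u) / 2, (u + v) / 2 + lam * (v - u) / 2)

/-- Maximal operator `M_{L log L}` on `ℝ`. -/
def MLlogL (f : ℝ → ℝ) (x : ℝ) : ℝ≥0∞ :=
  ⨆ (u : ℝ) (v : ℝ) (_ : u < v) (_ : x ∈ Ioc u v), ENNReal.ofReal (luxNormI 1 u v f)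

/-- John–Strömberg sharp maximal operator `M^♯_{0,s}` on `ℝ`. -/
def Msharp1 (s : ℝ) (g : ℝ → ℝ) (x : ℝ) : ℝ≥0∞ :=
  ⨆ (u : ℝ) (v : ℝ) (_ : u < v) (_ : x ∈ Ioc u v),
    ⨅ (b : ℝ), ⨅ (t : ℝ) (_ : 0 < t)
      (_ : volume {y ∈ Ioc u v | t < |g y - b|} < ENNReal.ofReal s * volume (Ioc u v)),
      ENNReal.ofReal t

/-- Membership in BMO(ℝ). -/
def MemBMO (g : ℝ → ℝ) : Prop :=
  ∃ M : ℝ, ∀ u v : ℝ, u < v →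
    (v - u)⁻¹ * (∫ y in Ioc u v, |g y - (v - u)⁻¹ * ∫ z in Ioc u v, g z|) ≤ M

end


/-- Decomposition of an open set without unbounded components into its components. -/
theorem ee_comp (U : Set ℝ) (hU : IsOpen U)
    (hb : ∀ x ∈ U, (∃ y, y < x ∧ y ∉ U) ∧ (∃ y, x < y ∧ y ∉ U)) :
    ∃ S : Set (ℝ × ℝ), S.Countable ∧ (∀ I ∈ S, I.1 < I.2 ∧ I.1 ∉ U ∧ I.2 ∉ U) ∧
      S.PairwiseDisjoint (fun I => Ioo I.1 I.2) ∧ (⋃ I ∈ S, Ioo I.1 I.2) = U := by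
  set S : Set (ℝ × ℝ) := {I | I.1 < I.2 ∧ I.1 ∉ U ∧ I.2 ∉ U ∧ Ioo I.1 I.2 ⊆ U} with hS
  have hdis : S.PairwiseDisjoint (fun I => Ioo I.1 I.2) := by
    rintro ⟨c, d⟩ ⟨h1, h2, h3, h4⟩ ⟨c', d'⟩ ⟨h1', h2', h3', h4'⟩ hne
    rw [Function.onFun, Set.disjoint_left]
    rintro z ⟨hz1, hz2⟩ ⟨hz1', hz2'⟩
    dsimp only at *
    apply hne
    have e1 : c = c' := by
      rcases lt_trichotomy c c' with h | h | h
      · exact absurd (h4 ⟨h, hz1'.trans hz2⟩) h2'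
      · exact h
      · exact absurd (h4' ⟨h, hz1.trans hz2'⟩) h2
    have e2 : d = d' := by
      rcases lt_trichotomy d d' with h | h | h
      · exact absurd (h4' ⟨hz1'.trans hz2, h⟩) h3
      · exact h
      · exact absurd (h4 ⟨hz1.trans hz2', h⟩) h3'
    rw [e1, e2]
  refine ⟨S, hdis.countable_of_isOpen (fun _ _ => isOpen_Ioo) (fun I hI => nonempty_Ioo.2 hI.1),
    fun I hI => ⟨hI.1, hI.2.1, hI.2.2.1⟩, hdis, ?_⟩
  apply Subset.antisymm
  · exact iUnion₂_subset fun I hI => hI.2.2.2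
  intro x hx
  obtain ⟨⟨y1, hy1, hy1U⟩, ⟨y2, hy2, hy2U⟩⟩ := hb x hx
  have hcl : IsClosed Uᶜ := hU.isClosed_compl
  set P := Uᶜ ∩ Iic x with hP
  set Q := Uᶜ ∩ Ici x with hQ
  have hPc : IsClosed P := hcl.inter isClosed_Iic
  have hQc : IsClosed Q := hcl.inter isClosed_Ici
  have hPb : BddAbove P := ⟨x, fun z hz => hz.2⟩
  have hQb : BddBelow Q := ⟨x, fun z hz => hz.2⟩
  have hPn : P.Nonempty := ⟨y1, hy1U, hy1.le⟩
  have hQn : Q.Nonempty := ⟨y2, hy2U, hy2.le⟩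
  have hc := hPc.csSup_mem hPn hPb
  have hd := hQc.csInf_mem hQn hQb
  have hcx : sSup P < x := lt_of_le_of_ne hc.2 (fun h => hc.1 (h ▸ hx))
  have hdx : x < sInf Q := lt_of_le_of_ne hd.2 (fun h => hd.1 (h ▸ hx))
  refine mem_iUnion₂.2 ⟨(sSup P, sInf Q), ⟨hcx.trans hdx, hc.1, hd.1, ?_⟩, ⟨hcx, hdx⟩⟩
  rintro z ⟨hz1, hz2⟩
  dsimp only at *
  by_contra hzU
  rcases le_total z x with h | h
  · exact absurd (le_csSup hPb ⟨hzU, h⟩) (not_le.2 hz1)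
  · exact absurd (csInf_le hQb ⟨hzU, h⟩) (not_le.2 hz2)

/-- Rising sun lemma. -/
theorem ee_rising (h : ℝ → ℝ) (hi : Integrable h) (h0 : ∀ x, 0 ≤ h x) :
    ∃ S : Set (ℝ × ℝ), S.Countable ∧ (∀ I ∈ S, I.1 < I.2) ∧
      (∀ I ∈ S, I.1 ∉ (⋃ J ∈ S, Ioo J.1 J.2) ∧ I.2 ∉ (⋃ J ∈ S, Ioo J.1 J.2)) ∧
      S.PairwiseDisjoint (fun I => Ioo I.1 I.2) ∧
      (∀ I ∈ S, ∫ t in I.1..I.2, h t = I.2 - I.1) ∧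
      volume (⋃ J ∈ S, Ioo J.1 J.2) ≤ ∫⁻ x, ENNReal.ofReal (h x) ∧
      ∀ᵐ x, x ∉ (⋃ J ∈ S, Ioo J.1 J.2) → h x ≤ 1 := by
  set F : ℝ → ℝ := fun x => (∫ t in (0:ℝ)..x, h t) - x with hF
  have hii : ∀ a b : ℝ, IntervalIntegrable h volume a b := fun a b => hi.intervalIntegrable
  have hFc : Continuous F :=
    (intervalIntegral.continuous_primitive hii 0).sub continuous_id
  have hFd : ∀ x y, F y - F x = (∫ t in x..y, h t) - (y - x) := by
    intro x y
    have := intervalIntegral.integral_interval_sub_left (hii 0 y) (hii 0 x)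
    simp only [hF]; rw [← this]; ring
  set H := ∫ x, h x with hH
  have hH0 : 0 ≤ H := integral_nonneg h0
  have hHle : ∀ x y, x ≤ y → ∫ t in x..y, h t ≤ H := by
    intro x y hxy
    rw [intervalIntegral.integral_of_le hxy]
    exact setIntegral_le_integral hi (Eventually.of_forall h0)
  set U : Set ℝ := {x | ∃ y, x < y ∧ F x < F y} with hUdef
  have hU : IsOpen U := by
    have : U = ⋃ y, ({x | x < y} ∩ {x | F x < F y}) := by
      ext x; simp [hUdef]
    rw [this]
    exact isOpen_iUnion fun y => (isOpen_lt continuous_id continuous_const).inter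
      (isOpen_lt hFc continuous_const)
  -- key property
  have key : ∀ x d, x < d → d ∉ U → (∀ z, x ≤ z → z < d → z ∈ U) → F x ≤ F d := by
    intro x d hxd hdU hz
    by_contra hlt
    push Not at hlt
    set P := Icc x d ∩ {z | F x ≤ F z} with hP
    have hPc : IsCompact P := isCompact_Icc.inter_right (isClosed_le continuous_const hFc)
    have hPn : P.Nonempty := ⟨x, ⟨le_rfl, hxd.le⟩, le_refl (F x)⟩
    have hm := hPc.sSup_mem hPn
    set z := sSup P
    have hzd : z < d := lt_of_le_of_ne hm.1.2 (fun e => by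
      have := hm.2; rw [e] at this; exact absurd this (not_le.2 hlt))
    obtain ⟨y, hy1, hy2⟩ := hz z hm.1.1 hzd
    have hm2 : F x ≤ F z := hm.2
    rcases le_or_gt y d with hyd | hyd
    · have : y ≤ z := le_csSup hPc.bddAbove ⟨⟨hm.1.1.trans hy1.le, hyd⟩, hm2.trans hy2.le⟩
      linarith
    · exact hdU ⟨y, hyd, by linarith⟩
  have hright : ∀ x, ∃ y, x ≤ y ∧ y ∉ U := by
    intro x
    obtain ⟨z, hz, hmax⟩ := (isCompact_Icc (a := x) (b := x + H + 1)).exists_isMaxOn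
      ⟨x, le_rfl, by linarith⟩ hFc.continuousOn
    refine ⟨z, hz.1, ?_⟩
    rintro ⟨y, hy1, hy2⟩
    have hxz : F x ≤ F z := hmax ⟨le_rfl, by linarith⟩
    rcases le_or_gt y (x + H + 1) with h1 | h1
    · have : F y ≤ F z := hmax ⟨hz.1.trans hy1.le, h1⟩
      linarith
    · have := hFd x y
      have := hHle x y (by linarith)
      linarith
  have hb : ∀ x ∈ U, (∃ y, y < x ∧ y ∉ U) ∧ (∃ y, x < y ∧ y ∉ U) := by
    intro x hx
    obtain ⟨y, hy, hyU⟩ := hright x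
    have hxy : x < y := lt_of_le_of_ne hy (fun e => hyU (e ▸ hx))
    refine ⟨?_, ⟨y, hxy, hyU⟩⟩
    by_contra hcon
    push Not at hcon
    set Q := Uᶜ ∩ Ici x with hQ
    have hQc : IsClosed Q := hU.isClosed_compl.inter isClosed_Ici
    have hQb : BddBelow Q := ⟨x, fun z hz => hz.2⟩
    have hd := hQc.csInf_mem ⟨y, hyU, hy⟩ hQb
    set d := sInf Q
    have hzU : ∀ z, z < d → z ∈ U := by
      intro z hz
      by_contra hzU
      rcases lt_or_ge z x with h1 | h1
      · exact hzU (hcon z h1)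
      · exact absurd (csInf_le hQb ⟨hzU, h1⟩) (not_le.2 hz)
    have := key (d - H - 1) d (by linarith) hd.1 (fun z _ hz => hzU z hz)
    have := hFd (d - H - 1) d
    have := hHle (d - H - 1) d (by linarith)
    linarith
  obtain ⟨S, hSc, hS1, hS2, hS3⟩ := ee_comp U hU hb
  have heq : ∀ I ∈ S, ∫ t in I.1..I.2, h t = I.2 - I.1 := by
    intro I hI
    obtain ⟨hlt, h1, h2⟩ := hS1 I hI
    have hsub : Ioo I.1 I.2 ⊆ U := by rw [← hS3]; exact subset_biUnion_of_mem (u := fun I : ℝ × ℝ => Ioo I.1 I.2) hI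
    have hle : F I.2 ≤ F I.1 := by
      by_contra hc
      push Not at hc
      exact h1 ⟨I.2, hlt, hc⟩
    have hge : F I.1 ≤ F I.2 := by
      have hx : ∀ x ∈ Ioo I.1 I.2, F x ≤ F I.2 := fun x hx =>
        key x I.2 hx.2 h2 (fun z hz1 hz2 => hsub ⟨hx.1.trans_le hz1, hz2⟩)
      have : I.1 ∈ closure (Ioo I.1 I.2) := by
        rw [closure_Ioo hlt.ne]; exact ⟨le_rfl, hlt.le⟩
      exact (closure_minimal (fun x hx' => hx x hx')
        (isClosed_le hFc continuous_const)) this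
    have := hFd I.1 I.2
    linarith
  refine ⟨S, hSc, fun I hI => (hS1 I hI).1, ?_, hS2, heq, ?_, ?_⟩
  · rw [hS3]; exact fun I hI => (hS1 I hI).2
  · rw [measure_biUnion hSc hS2 (fun _ _ => measurableSet_Ioo)]
    calc ∑' I : S, volume (Ioo I.1.1 I.1.2)
        = ∑' I : S, ∫⁻ x in Ioo I.1.1 I.1.2, ENNReal.ofReal (h x) := by
          congr 1; ext I
          rw [Real.volume_Ioo, ← heq I.1 I.2, intervalIntegral.integral_of_le (hS1 I.1 I.2).1.le,
            integral_Ioc_eq_integral_Ioo, ofReal_integral_eq_lintegral_ofReal hi.integrableOn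
              (Eventually.of_forall h0)]
      _ = ∫⁻ x in ⋃ I ∈ S, Ioo I.1 I.2, ENNReal.ofReal (h x) := by
          rw [lintegral_biUnion hSc (fun _ _ => measurableSet_Ioo) hS2]
      _ ≤ _ := setLIntegral_le_lintegral _ _
  · rw [hS3]
    filter_upwards [LocallyIntegrable.ae_hasDerivAt_integral hi.locallyIntegrable] with x hx hxU
    have hd : HasDerivAt F (h x - 1) x := (hx 0).sub (hasDerivAt_id x)
    have hle : ∀ y, x < y → F y ≤ F x := by
      intro y hy
      by_contra hc
      push Not at hc
      exact hxU ⟨y, hy, hc⟩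
    have ht := hd.hasDerivWithinAt (s := Ioi x)
    rw [hasDerivWithinAt_iff_tendsto_slope' (by simp)] at ht
    have : h x - 1 ≤ 0 := by
      refine le_of_tendsto ht ?_
      filter_upwards [self_mem_nhdsWithin] with y hy
      rw [slope_def_field]
      exact div_nonpos_of_nonpos_of_nonneg (by linarith [hle y hy]) (by have : x < y := hy; linarith)
    linarith


theorem ee_meas_deriv {A A' : ℝ → ℝ} (hA : ∀ x, HasDerivAt A (A' x) x) : Measurable A' := by
  have : A' = deriv A := by ext x; exact (hA x).deriv.symm
  rw [this]; exact measurable_deriv A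

theorem ee_bmo_slope {A A' : ℝ → ℝ} (hA : ∀ x, HasDerivAt A (A' x) x) {M : ℝ}
    (hM : ∀ u v : ℝ, u < v →
      (v - u)⁻¹ * (∫ y in Ioc u v, |A' y - (v - u)⁻¹ * ∫ z in Ioc u v, A' z|) ≤ M)
    {u v : ℝ} (huv : u < v) (hi : IntegrableOn A' (Ioc u v)) :
    ∫ y in Ioc u v, |A' y - (A v - A u) / (v - u)| ≤ M * (v - u) := by
  have h1 := hM u v huv
  have h2 : ∫ z in Ioc u v, A' z = A v - A u := by
    rw [← intervalIntegral.integral_of_le huv.le]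
    exact intervalIntegral.integral_eq_sub_of_hasDerivAt (fun x _ => hA x)
      ((intervalIntegrable_iff_integrableOn_Ioc_of_le huv.le).2 hi)
  rw [h2] at h1
  have hpos : 0 < v - u := by linarith
  rw [inv_mul_le_iff₀ hpos] at h1
  rw [div_eq_inv_mul, mul_comm M]; exact h1

theorem ee_l1 {A A' : ℝ → ℝ} (hA : ∀ x, HasDerivAt A (A' x) x) {M : ℝ}
    (hM : ∀ u v : ℝ, u < v →
      (v - u)⁻¹ * (∫ y in Ioc u v, |A' y - (v - u)⁻¹ * ∫ z in Ioc u v, A' z|) ≤ M)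
    {u v : ℝ} (huv : u < v) (hi : IntegrableOn A' (Ioc u v)) :
    ∫⁻ y in Ioc u v, ‖A' y‖ₑ ≤ ENNReal.ofReal (M * (v - u) + |A v - A u|) := by
  rw [← ofReal_integral_norm_eq_lintegral_enorm hi]
  apply ENNReal.ofReal_le_ofReal
  have hpos : 0 < v - u := by linarith
  set s := (A v - A u) / (v - u) with hs
  have hc : IntegrableOn (fun _ : ℝ => s) (Ioc u v) := integrableOn_const (by simp)
  have h2 : IntegrableOn (fun y => |A' y - s|) (Ioc u v) := (hi.sub hc).abs
  calc ∫ y in Ioc u v, ‖A' y‖ ≤ ∫ y in Ioc u v, (|A' y - s| + |s|) := by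
        apply integral_mono hi.norm (h2.add hc.abs)
        intro y
        have := abs_add_le (A' y - s) s
        simp only [sub_add_cancel] at this
        exact this
    _ = (∫ y in Ioc u v, |A' y - s|) + (v - u) * |s| := by
        rw [integral_add h2 hc.abs]; simp [hpos.le]
    _ ≤ M * (v - u) + |A v - A u| := by
        have : (v - u) * |s| = |A v - A u| := by
          rw [hs, abs_div, abs_of_pos hpos]; field_simp
        rw [this]
        linarith [ee_bmo_slope hA hM huv hi]

theorem ee_l1_open {A A' : ℝ → ℝ} (hA : ∀ x, HasDerivAt A (A' x) x) {M : ℝ}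
    (hM : ∀ u v : ℝ, u < v →
      (v - u)⁻¹ * (∫ y in Ioc u v, |A' y - (v - u)⁻¹ * ∫ z in Ioc u v, A' z|) ≤ M)
    {c d : ℝ} (hcd : c < d) (hi : ∀ x ∈ Ioo c d, IntegrableAtFilter A' (nhds x) volume) :
    ∫⁻ y in Ioo c d, ‖A' y‖ₑ ≤ ENNReal.ofReal (M * (d - c) + |A d - A c|) := by
  have hAc : Continuous A := continuous_iff_continuousAt.2 fun x => (hA x).continuousAt
  set δ : ℕ → ℝ := fun n => (d - c) / (n + 3) with hδ
  have hδ0 : Tendsto δ atTop (nhds 0) := by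
    have h1 : Tendsto (fun n : ℕ => ((n : ℝ) + 3)) atTop atTop :=
      tendsto_atTop_add_const_right _ _ tendsto_natCast_atTop_atTop
    exact h1.const_div_atTop (d - c)
  have hδp : ∀ n, 0 < δ n := fun n => div_pos (by linarith) (by positivity)
  have hδl : ∀ n, 3 * δ n ≤ d - c := by
    intro n
    have h3 : (0:ℝ) < n + 3 := by positivity
    rw [hδ]; simp only
    rw [← mul_div_assoc, div_le_iff₀ h3]
    have : (0:ℝ) ≤ n := by positivity
    nlinarith
  have hca : Tendsto (fun n => c + δ n) atTop (nhds c) := by simpa using hδ0.const_add c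
  have hda : Tendsto (fun n => d - δ n) atTop (nhds d) := by simpa using hδ0.const_sub d
  have hcov := aecover_Ioo_of_Ioc (μ := (volume : Measure ℝ)) hca hda
  have hm : AEMeasurable (fun y => ‖A' y‖ₑ) (volume.restrict (Ioo c d)) :=
    ((ee_meas_deriv hA).enorm).aemeasurable
  have ht := hcov.lintegral_tendsto_of_countably_generated hm
  have ht2 : Tendsto (fun n => ENNReal.ofReal (M * ((d - δ n) - (c + δ n)) +
      |A (d - δ n) - A (c + δ n)|)) atTop (nhds (ENNReal.ofReal (M * (d - c) + |A d - A c|))) := by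
    apply (ENNReal.continuous_ofReal.tendsto _).comp
    exact ((hda.sub hca).const_mul M).add
      ((((hAc.tendsto d).comp hda).sub ((hAc.tendsto c).comp hca)).abs)
  refine le_of_tendsto_of_tendsto' ht ht2 fun n => ?_
  have hp := hδp n
  have hl := hδl n
  have hlt : c + δ n < d - δ n := by linarith
  refine le_trans (lintegral_mono' (Measure.restrict_mono_measure Measure.restrict_le_self _)
    le_rfl) (ee_l1 hA hM hlt ?_)
  have : LocallyIntegrableOn A' (Icc (c + δ n) (d - δ n)) := fun x hx =>
    (hi x ⟨by linarith [hx.1], by linarith [hx.2]⟩).filter_mono nhdsWithin_le_nhds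
  exact (this.integrableOn_isCompact isCompact_Icc).mono_set Ioc_subset_Icc_self

theorem ee_locint {A A' : ℝ → ℝ} (hA : ∀ x, HasDerivAt A (A' x) x) {M : ℝ} (hM0 : 0 ≤ M)
    (hM : ∀ u v : ℝ, u < v →
      (v - u)⁻¹ * (∫ y in Ioc u v, |A' y - (v - u)⁻¹ * ∫ z in Ioc u v, A' z|) ≤ M) :
    LocallyIntegrable A' volume := by
  have hAc : Continuous A := continuous_iff_continuousAt.2 fun x => (hA x).continuousAt
  set G : Set ℝ := {x | IntegrableAtFilter A' (nhds x) volume} with hG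
  have hGo : IsOpen G := by
    rw [isOpen_iff_mem_nhds]
    rintro x ⟨s, hs, his⟩
    filter_upwards [eventually_mem_nhds_iff.2 hs] with y hy
    exact ⟨s, hy, his⟩
  by_contra hcon
  have hne : (Gᶜ).Nonempty := by
    by_contra h
    rw [not_nonempty_iff_eq_empty, compl_empty_iff] at h
    exact hcon fun x => by
      have : x ∈ G := h ▸ mem_univ x
      exact this
  have hcl : IsClosed Gᶜ := hGo.isClosed_compl
  have : CompleteSpace (Gᶜ : Set ℝ) := hcl.completeSpace_coe
  have : Nonempty (Gᶜ : Set ℝ) := hne.to_subtype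
  set N : ℕ → Set (Gᶜ : Set ℝ) := fun n =>
    {x | ∀ y, |y - x.1| ≤ 1 / (n + 1 : ℝ) → |A y - A x.1| ≤ (n + 1 : ℝ) * |y - x.1|} with hN
  have hNc : ∀ n, IsClosed (N n) := by
    intro n
    have : N n = ⋂ z ∈ Icc (-(1 / (n + 1 : ℝ))) (1 / (n + 1 : ℝ)),
        {x : (Gᶜ : Set ℝ) | |A (x.1 + z) - A x.1| ≤ (n + 1 : ℝ) * |z|} := by
      ext x
      simp only [hN, mem_setOf_eq, mem_iInter]
      constructor
      · intro h z hz
        have := h (x.1 + z) (by rw [add_sub_cancel_left, abs_le]; exact hz)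
        simpa using this
      · intro h y hy
        have := h (y - x.1) (by rw [abs_le] at hy; exact hy)
        simpa using this
    rw [this]
    refine isClosed_biInter fun z _ => isClosed_le ?_ continuous_const
    exact ((hAc.comp (continuous_subtype_val.add continuous_const)).sub
      (hAc.comp continuous_subtype_val)).abs
  have hNu : ⋃ n, N n = univ := by
    rw [eq_univ_iff_forall]
    intro x
    obtain ⟨K, hK⟩ := (hA x.1).isBigO_sub.bound
    obtain ⟨ε, hε, hb⟩ := Metric.eventually_nhds_iff.1 hK
    obtain ⟨n, hn⟩ := exists_nat_gt (max K (1 / ε))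
    have hn1 : K < n := (le_max_left _ _).trans_lt hn
    have hn2 : 1 / ε < n := (le_max_right _ _).trans_lt hn
    refine mem_iUnion.2 ⟨n, fun y hy => ?_⟩
    have h3 : 1 / (n + 1 : ℝ) < ε := by
      rw [div_lt_comm₀ (by positivity) hε]; linarith
    have := hb (y := y) (by rw [Real.dist_eq]; linarith)
    simp only [Real.norm_eq_abs] at this
    refine this.trans (mul_le_mul_of_nonneg_right (by linarith) (abs_nonneg _))
  obtain ⟨n, x0, hx0⟩ := nonempty_interior_of_iUnion_of_closed hNc hNu
  rw [mem_interior_iff_mem_nhds, Metric.mem_nhds_iff] at hx0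
  obtain ⟨ε, hε, hball⟩ := hx0
  have hn1 : (0:ℝ) < n + 1 := by positivity
  set δ : ℝ := min ε (1 / (n + 1)) / 2 with hδ
  have hδ0 : 0 < δ := by have : 0 < 1 / (n + 1 : ℝ) := by positivity
                         have := lt_min hε this
                         positivity
  have hδ1 : δ < ε := by have := min_le_left ε (1 / (n + 1 : ℝ)); linarith
  have hδ2 : 2 * δ ≤ 1 / (n + 1) := by have := min_le_right ε (1 / (n + 1 : ℝ)); linarith
  set U := Ioo (x0.1 - δ) (x0.1 + δ) with hU
  have hlip : ∀ x ∈ U, x ∉ G → ∀ y, |y - x| ≤ 1 / (n + 1 : ℝ) →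
      |A y - A x| ≤ (n + 1 : ℝ) * |y - x| := by
    intro x hx hxG
    have : (⟨x, hxG⟩ : (Gᶜ : Set ℝ)) ∈ N n := by
      apply hball
      rw [Metric.mem_ball, Subtype.dist_eq, Real.dist_eq, abs_lt]
      exact ⟨by linarith [hx.1], by linarith [hx.2]⟩
    exact this
  obtain ⟨S, hSc, hS1, hS2, hS3⟩ := ee_comp (U ∩ G) (isOpen_Ioo.inter hGo) (by
    intro x hx
    exact ⟨⟨x0.1 - δ, hx.1.1, fun h => lt_irrefl _ h.1.1⟩,
      ⟨x0.1 + δ, hx.1.2, fun h => lt_irrefl _ h.1.2⟩⟩)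
  have hW : ∫⁻ y in U ∩ G, ‖A' y‖ₑ ≤ ENNReal.ofReal (M + (n + 1)) * volume (U ∩ G) := by
    rw [← hS3, lintegral_biUnion hSc (fun _ _ => measurableSet_Ioo) hS2,
      measure_biUnion hSc hS2 (fun _ _ => measurableSet_Ioo), ← ENNReal.tsum_mul_left]
    apply ENNReal.tsum_le_tsum
    rintro ⟨⟨c, d⟩, hI⟩
    obtain ⟨hlt, hc, hd⟩ := hS1 _ hI
    dsimp only at *
    have hsub : Ioo c d ⊆ U ∩ G := by
      rw [← hS3]; exact subset_biUnion_of_mem (u := fun I : ℝ × ℝ => Ioo I.1 I.2) hI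
    have hsub2 : Icc c d ⊆ Icc (x0.1 - δ) (x0.1 + δ) := by
      rw [← closure_Ioo hlt.ne]
      exact closure_minimal (fun z hz => Ioo_subset_Icc_self (hsub hz).1) isClosed_Icc
    have hc2 := hsub2 ⟨le_rfl, hlt.le⟩
    have hd2 := hsub2 ⟨hlt.le, le_rfl⟩
    have hdc : |d - c| ≤ 1 / (n + 1 : ℝ) := by
      rw [abs_of_pos (by linarith)]; linarith [hc2.1, hd2.2]
    have hAdc : |A d - A c| ≤ (n + 1) * (d - c) := by
      rw [← abs_of_pos (show 0 < d - c by linarith)]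
      by_cases hcU : c ∈ U
      · exact hlip c hcU (fun h => hc ⟨hcU, h⟩) d hdc
      by_cases hdU : d ∈ U
      · rw [abs_sub_comm, abs_sub_comm d c]
        exact hlip d hdU (fun h => hd ⟨hdU, h⟩) c (by rw [abs_sub_comm]; exact hdc)
      exfalso
      have e1 : c = x0.1 - δ := by
        by_contra hne
        exact hcU ⟨lt_of_le_of_ne hc2.1 (Ne.symm hne), by linarith [hd2.2]⟩
      have e2 : d = x0.1 + δ := by
        by_contra hne
        exact hdU ⟨by linarith [hc2.1], lt_of_le_of_ne hd2.2 hne⟩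
      exact x0.2 (hsub ⟨by linarith, by linarith⟩).2
    refine (ee_l1_open hA hM hlt (fun x hx => (hsub hx).2)).trans ?_
    rw [Real.volume_Ioo, ← ENNReal.ofReal_mul (by positivity)]
    apply ENNReal.ofReal_le_ofReal
    nlinarith
  have hR : ∫⁻ y in U ∩ Gᶜ, ‖A' y‖ₑ ≤ ENNReal.ofReal (n + 1) * volume (U ∩ Gᶜ) := by
    rw [← setLIntegral_const]
    apply setLIntegral_mono' (measurableSet_Ioo.inter hcl.measurableSet)
    intro x hx
    rw [← ofReal_norm]
    apply ENNReal.ofReal_le_ofReal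
    refine (hA x).le_of_lip' hn1.le ?_
    rw [Metric.eventually_nhds_iff]
    refine ⟨1 / (n + 1), by positivity, fun y hy => hlip x hx.1 hx.2 y ?_⟩
    rw [← Real.dist_eq]; exact hy.le
  have hUf : volume U < ∞ := by rw [hU, Real.volume_Ioo]; exact ENNReal.ofReal_lt_top
  have hIntg : IntegrableOn A' U := by
    refine ⟨(ee_meas_deriv hA).aestronglyMeasurable, ?_⟩
    rw [HasFiniteIntegral]
    have : U = (U ∩ G) ∪ (U ∩ Gᶜ) := by rw [inter_union_compl]
    rw [this]
    refine (lintegral_union_le _ _ _).trans_lt (ENNReal.add_lt_top.2 ⟨hW.trans_lt ?_, hR.trans_lt ?_⟩)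
    · exact ENNReal.mul_lt_top ENNReal.ofReal_lt_top ((measure_mono inter_subset_left).trans_lt hUf)
    · exact ENNReal.mul_lt_top ENNReal.ofReal_lt_top ((measure_mono inter_subset_left).trans_lt hUf)
  exact x0.2 ⟨U, Ioo_mem_nhds (by linarith) (by linarith), hIntg⟩


/-- Slope of `A` over `(u,v)`, i.e. the mean of `A'`. -/
noncomputable def eeSl (A : ℝ → ℝ) (u v : ℝ) : ℝ := (A v - A u) / (v - u)

/-- A function with locally integrable derivative in BMO, usable form. -/
structure eeBMO (A A' : ℝ → ℝ) (M : ℝ) : Prop where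
  der : ∀ x, HasDerivAt A (A' x) x
  pos : 0 < M
  loc : LocallyIntegrable A' volume
  osc : ∀ u v : ℝ, u < v → ∫ y in Ioc u v, |A' y - eeSl A u v| ≤ M * (v - u)

theorem eeBMO_of {A A' : ℝ → ℝ} (hA : ∀ x, HasDerivAt A (A' x) x) (hb : MemBMO A') :
    ∃ M, eeBMO A A' M := by
  obtain ⟨M, hM⟩ := hb
  have hM' : ∀ u v : ℝ, u < v →
      (v - u)⁻¹ * (∫ y in Ioc u v, |A' y - (v - u)⁻¹ * ∫ z in Ioc u v, A' z|) ≤ max M 1 :=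
    fun u v h => (hM u v h).trans (le_max_left _ _)
  have h0 : 0 < max M 1 := lt_of_lt_of_le one_pos (le_max_right _ _)
  have hl := ee_locint hA h0.le hM'
  refine ⟨max M 1, hA, h0, hl, fun u v huv => ee_bmo_slope hA hM' huv ?_⟩
  exact (hl.integrableOn_isCompact isCompact_Icc).mono_set Ioc_subset_Icc_self

namespace eeBMO
variable {A A' : ℝ → ℝ} {M : ℝ}

theorem meas (h : eeBMO A A' M) : Measurable A' := ee_meas_deriv h.der

theorem cont (h : eeBMO A A' M) : Continuous A :=
  continuous_iff_continuousAt.2 fun x => (h.der x).continuousAt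

theorem ion (h : eeBMO A A' M) (u v : ℝ) : IntegrableOn A' (Ioc u v) :=
  (h.loc.integrableOn_isCompact isCompact_Icc).mono_set Ioc_subset_Icc_self

theorem ionk (h : eeBMO A A' M) (u v k : ℝ) : IntegrableOn (fun y => |A' y - k|) (Ioc u v) :=
  ((h.ion u v).sub (integrableOn_const (by simp))).abs

theorem iik (h : eeBMO A A' M) (u v k : ℝ) : IntervalIntegrable (fun y => A' y - k) volume u v := by
  rw [intervalIntegrable_iff]
  exact (h.ion _ _).sub (integrableOn_const (by simp [uIoc]))

theorem ftc (h : eeBMO A A' M) (x y k : ℝ) : A x - A y - k * (x - y) = ∫ t in y..x, (A' t - k) := by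
  rw [intervalIntegral.integral_sub, intervalIntegral.integral_eq_sub_of_hasDerivAt
    (fun x _ => h.der x)]
  · simp; ring
  · exact (intervalIntegrable_iff.2 (h.ion _ _))
  · exact (intervalIntegrable_iff.2 (h.ion _ _))
  · simp

theorem slope_le (h : eeBMO A A' M) {c d u v : ℝ} (hcd : c < d) (huc : u ≤ c) (hdv : d ≤ v) (k : ℝ) :
    |eeSl A c d - k| * (d - c) ≤ ∫ y in Ioc u v, |A' y - k| := by
  have hp : 0 < d - c := by linarith
  have h1 : |eeSl A c d - k| * (d - c) = |∫ t in c..d, (A' t - k)| := by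
    rw [← h.ftc, ← abs_of_pos hp, ← abs_mul, eeSl, abs_of_pos hp]
    congr 1; field_simp
  rw [h1]
  calc |∫ t in c..d, (A' t - k)| ≤ ∫ t in c..d, |A' t - k| :=
        intervalIntegral.abs_integral_le_integral_abs hcd.le
    _ = ∫ t in Ioc c d, |A' t - k| := intervalIntegral.integral_of_le hcd.le
    _ ≤ _ := setIntegral_mono_set (h.ionk _ _ _) (Eventually.of_forall fun _ => abs_nonneg _)
        (Ioc_subset_Ioc huc hdv).eventuallyLE

theorem int_le (h : eeBMO A A' M) {u v : ℝ} (huv : u < v) (k : ℝ) :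
    ∫ y in Ioc u v, |A' y - k| ≤ (v - u) * (M + |eeSl A u v - k|) := by
  have hp : 0 < v - u := by linarith
  calc ∫ y in Ioc u v, |A' y - k| ≤ ∫ y in Ioc u v, (|A' y - eeSl A u v| + |eeSl A u v - k|) := by
        apply integral_mono (h.ionk _ _ _) ((h.ionk _ _ _).add (integrableOn_const (by simp)))
        intro y
        exact abs_sub_le _ _ _
    _ = (∫ y in Ioc u v, |A' y - eeSl A u v|) + (v - u) * |eeSl A u v - k| := by
        rw [integral_add (h.ionk _ _ _) (integrableOn_const (by simp))]; simp [hp.le]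
    _ ≤ _ := by linarith [h.osc u v huv]

/-- John–Nirenberg decay. -/
theorem jn (h : eeBMO A A' M) (k : ℕ) : ∀ u v : ℝ, u < v →
    volume {x ∈ Ioc u v | k * (24 * M) < |A' x - eeSl A u v|} ≤
      ENNReal.ofReal ((1 / 2) ^ k * (v - u)) := by
  induction k with
  | zero =>
    intro u v huv
    refine (measure_mono (sep_subset _ _)).trans ?_
    simp
  | succ k ih =>
    intro u v huv
    have hp : 0 < v - u := by linarith
    have hM := h.pos
    set lam := 24 * M with hlam
    have hlam0 : 0 < lam := by positivity
    set s := eeSl A u v with hs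
    set J := Ioc (2 * u - v) (2 * v - u) with hJ
    set φ : ℝ → ℝ := J.indicator (fun y => |A' y - s| / lam) with hφ
    have hφi : Integrable φ := by
      rw [hφ, integrable_indicator_iff measurableSet_Ioc]
      exact (h.ionk _ _ _).div_const _
    have hφ0 : ∀ x, 0 ≤ φ x := fun x => indicator_nonneg (fun y _ => by positivity) x
    have hφI : ∫ x, φ x ≤ (v - u) / 2 := by
      rw [hφ, integral_indicator measurableSet_Ioc, integral_div]
      have e1 := h.int_le (u := 2 * u - v) (v := 2 * v - u) (by linarith) s
      have e2 := h.slope_le (c := u) (d := v) (u := 2 * u - v) (v := 2 * v - u) huv (by linarith)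
        (by linarith) (eeSl A (2 * u - v) (2 * v - u))
      have e3 := h.osc (2 * u - v) (2 * v - u) (by linarith)
      rw [abs_sub_comm, ← hs] at e2
      rw [div_le_div_iff₀ hlam0 two_pos]
      nlinarith
    obtain ⟨S, hSc, hS1, -, hS2, hS3, hS4, hS5⟩ := ee_rising φ hφi hφ0
    set U := ⋃ J ∈ S, Ioo J.1 J.2 with hU
    have hUv : volume U ≤ ENNReal.ofReal ((v - u) / 2) := by
      refine hS4.trans ?_
      rw [← ofReal_integral_eq_lintegral_ofReal hφi (Eventually.of_forall hφ0)]
      exact ENNReal.ofReal_le_ofReal hφI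
    have hlen : ∀ I ∈ S, I.2 - I.1 ≤ (v - u) / 2 := by
      intro I hI
      have : volume (Ioo I.1 I.2) ≤ ENNReal.ofReal ((v - u) / 2) :=
        (measure_mono (subset_biUnion_of_mem (u := fun I : ℝ × ℝ => Ioo I.1 I.2) hI)).trans hUv
      rw [Real.volume_Ioo, ENNReal.ofReal_le_ofReal_iff (by positivity)] at this
      exact this
    set E := {x ∈ Ioc u v | ((k + 1 : ℕ) : ℝ) * lam < |A' x - s|} with hE
    have hsub : E ≤ᵐ[volume] ⋃ I ∈ S, {x ∈ Ioc I.1 I.2 | k * lam < |A' x - eeSl A I.1 I.2|} := by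
      filter_upwards [hS5] with x hx hxE
      obtain ⟨hxI, hxl⟩ := hxE
      have hxJ : x ∈ J := ⟨by linarith [hxI.1], by linarith [hxI.2]⟩
      have hφx : φ x = |A' x - s| / lam := indicator_of_mem hxJ _
      have hkl : (0:ℝ) ≤ k * lam := by positivity
      push_cast at hxl
      have hxU : x ∈ U := by
        by_contra hxU
        have := hx hxU
        rw [hφx, div_le_one hlam0] at this
        nlinarith
      obtain ⟨I, hI, hxI2⟩ := mem_iUnion₂.1 hxU
      refine mem_iUnion₂.2 ⟨I, hI, ⟨hxI2.1, hxI2.2.le⟩, ?_⟩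
      have hl := hlen I hI
      have hI1 : 2 * u - v ≤ I.1 := by linarith [hxI2.2, hxI.1]
      have hI2 : I.2 ≤ 2 * v - u := by linarith [hxI2.1, hxI.2]
      have hlt := hS1 I hI
      have e1 := h.slope_le hlt le_rfl le_rfl s
      have e2 : ∫ y in Ioc I.1 I.2, |A' y - s| = lam * (I.2 - I.1) := by
        rw [← hS3 I hI, intervalIntegral.integral_of_le hlt.le, ← integral_const_mul]
        apply setIntegral_congr_fun measurableSet_Ioc
        intro y hy
        have : φ y = |A' y - s| / lam :=
          indicator_of_mem (Ioc_subset_Ioc hI1 hI2 hy) _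
        simp only [this]; field_simp
      rw [e2] at e1
      have e3 : |eeSl A I.1 I.2 - s| ≤ lam := le_of_mul_le_mul_right e1 (by linarith)
      have e4 := abs_sub_le (A' x) (eeSl A I.1 I.2) s
      linarith
    calc volume E ≤ volume (⋃ I ∈ S, {x ∈ Ioc I.1 I.2 | k * lam < |A' x - eeSl A I.1 I.2|}) :=
          measure_mono_ae hsub
      _ ≤ ∑' I : S, volume {x ∈ Ioc I.1.1 I.1.2 | k * lam < |A' x - eeSl A I.1.1 I.1.2|} :=
          measure_biUnion_le _ hSc _
      _ ≤ ∑' I : S, ENNReal.ofReal ((1 / 2) ^ k) * volume (Ioo I.1.1 I.1.2) := by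
          apply ENNReal.tsum_le_tsum
          intro I
          rw [Real.volume_Ioo, ← ENNReal.ofReal_mul (by positivity)]
          exact ih _ _ (hS1 I.1 I.2)
      _ = ENNReal.ofReal ((1 / 2) ^ k) * volume U := by
          rw [ENNReal.tsum_mul_left, hU, measure_biUnion hSc hS2 (fun _ _ => measurableSet_Ioo)]
      _ ≤ ENNReal.ofReal ((1 / 2) ^ k) * ENNReal.ofReal ((v - u) / 2) := by gcongr
      _ = _ := by
          rw [← ENNReal.ofReal_mul (by positivity)]; congr 1; ring

/-- John–Nirenberg, exponential form. -/
theorem jn_exp (h : eeBMO A A' M) : ∃ κ : ℝ, 0 < κ ∧ ∀ u v : ℝ, u < v →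
    ∫⁻ y in Ioc u v, ENNReal.ofReal (Real.exp (κ * |A' y - eeSl A u v|)) ≤
      ENNReal.ofReal (7 * (v - u)) := by
  have hM := h.pos
  set lam := 24 * M with hlam
  have hlam0 : 0 < lam := by positivity
  have hlog : 0 < Real.log (3 / 2) := Real.log_pos (by norm_num)
  set κ := Real.log (3 / 2) / lam with hκ
  refine ⟨κ, by positivity, fun u v huv => ?_⟩
  have hp : 0 < v - u := by linarith
  set s := fun y => |A' y - eeSl A u v| with hs
  have hsm : Measurable s := (h.meas.sub_const _).abs
  have hpt : ∀ y, ENNReal.ofReal (Real.exp (κ * s y)) ≤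
      1 + ∑' k : ℕ, {y | (k : ℝ) * lam < s y}.indicator
        (fun _ => ENNReal.ofReal ((3 / 2) ^ (k + 1))) y := by
    intro y
    have hsy : 0 ≤ s y := abs_nonneg _
    rcases hsy.eq_or_lt with h0 | h0
    · rw [← h0]; simp
    have hex : ∃ k : ℕ, (k : ℝ) * lam < s y ∧ s y ≤ (k + 1) * lam := by
      have hc : 0 < ⌈s y / lam⌉₊ := Nat.ceil_pos.2 (by positivity)
      obtain ⟨k, hk⟩ : ∃ k, ⌈s y / lam⌉₊ = k + 1 := ⟨_, (Nat.succ_pred_eq_of_pos hc).symm⟩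
      refine ⟨k, ?_, ?_⟩
      · have : k < ⌈s y / lam⌉₊ := by omega
        rw [Nat.lt_ceil, lt_div_iff₀ hlam0] at this
        exact this
      · have := Nat.le_ceil (s y / lam)
        rw [hk, div_le_iff₀ hlam0] at this
        push_cast at this; exact this
    obtain ⟨k, hk1, hk2⟩ := hex
    refine le_trans ?_ le_add_self
    refine le_trans ?_ (ENNReal.le_tsum k)
    rw [indicator_of_mem (by exact hk1)]
    apply ENNReal.ofReal_le_ofReal
    have : ((3:ℝ) / 2) ^ (k + 1) = Real.exp (Real.log (3 / 2) * (k + 1)) := by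
      rw [mul_comm, ← Real.log_rpow (by norm_num), Real.exp_log (by positivity)]
      exact_mod_cast rfl
    rw [this]
    apply Real.exp_le_exp.2
    rw [hκ, div_mul_eq_mul_div, div_le_iff₀ hlam0]
    nlinarith
  have hms : ∀ k : ℕ, MeasurableSet {y | (k : ℝ) * lam < s y} := fun k =>
    measurableSet_lt measurable_const hsm
  calc ∫⁻ y in Ioc u v, ENNReal.ofReal (Real.exp (κ * s y))
      ≤ ∫⁻ y in Ioc u v, (1 + ∑' k : ℕ, {y | (k : ℝ) * lam < s y}.indicator
        (fun _ => ENNReal.ofReal ((3 / 2) ^ (k + 1))) y) := lintegral_mono hpt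
    _ = ENNReal.ofReal (v - u) + ∑' k : ℕ, ENNReal.ofReal ((3 / 2) ^ (k + 1)) *
          volume {y ∈ Ioc u v | (k : ℝ) * lam < s y} := by
        rw [lintegral_add_left measurable_const, lintegral_tsum
          (fun k => (measurable_const.indicator (hms k)).aemeasurable)]
        congr 1
        · simp
        · congr 1; ext k
          rw [lintegral_indicator (hms k), setLIntegral_const, Measure.restrict_apply (hms k)]
          congr 2
          ext y; simp [and_comm]
    _ ≤ ENNReal.ofReal (v - u) + ∑' k : ℕ, ENNReal.ofReal ((3 / 2) * (v - u) * (3 / 4) ^ k) := by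
        gcongr with k
        refine (mul_le_mul_right (h.jn k u v huv) _).trans ?_
        rw [← ENNReal.ofReal_mul (by positivity)]
        apply ENNReal.ofReal_le_ofReal
        apply le_of_eq
        have : ((3:ℝ) / 4) ^ k = (3 / 2) ^ k * (1 / 2) ^ k := by rw [← mul_pow]; norm_num
        rw [this]; ring
    _ = ENNReal.ofReal (v - u) + ENNReal.ofReal (6 * (v - u)) := by
        congr 1
        rw [← ENNReal.ofReal_tsum_of_nonneg (fun k => by positivity)
          ((summable_geometric_of_lt_one (by norm_num) (by norm_num)).mul_left _),
          tsum_mul_left, tsum_geometric_of_lt_one (by norm_num) (by norm_num)]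
        congr 1; ring
    _ = _ := by
        rw [← ENNReal.ofReal_add (by positivity) (by positivity)]; congr 1; ring

end eeBMO


theorem ee_young (q b : ℝ) (hq : 1 ≤ q) (hb : 0 ≤ b) (hqb : q = 1 → 1 ≤ b) :
    ∃ K : ℝ, 0 < K ∧ ∀ s t : ℝ, 0 ≤ s → 0 ≤ t →
      s * t ≤ K * (Real.exp (2 * s) + t ^ q * Real.log (Real.exp 1 + t) ^ b) := by
  have hlog : ∀ t : ℝ, 0 ≤ t → 1 ≤ Real.log (Real.exp 1 + t) := by
    intro t ht
    rw [Real.le_log_iff_exp_le (by positivity)]; linarith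
  rcases hq.eq_or_lt with h1 | h1
  · refine ⟨1, one_pos, fun s t hs ht => ?_⟩
    have hl := hlog t ht
    rw [← h1, Real.rpow_one, one_mul]
    have hΦ : 0 ≤ t * Real.log (Real.exp 1 + t) ^ b := by positivity
    rcases le_or_gt s (Real.log (Real.exp 1 + t)) with h2 | h2
    · have : Real.log (Real.exp 1 + t) ≤ Real.log (Real.exp 1 + t) ^ b := by
        conv_lhs => rw [← Real.rpow_one (Real.log (Real.exp 1 + t))]
        exact Real.rpow_le_rpow_of_exponent_le hl (hqb h1.symm)
      have h3 : s * t ≤ t * Real.log (Real.exp 1 + t) ^ b := by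
        rw [mul_comm]; exact mul_le_mul_of_nonneg_left (h2.trans this) ht
      linarith [Real.exp_pos (2 * s)]
    · rw [Real.log_lt_iff_lt_exp (by positivity)] at h2
      have h3 : s ≤ Real.exp s := by linarith [Real.add_one_le_exp s]
      have h4 : s * t ≤ Real.exp s * Real.exp s :=
        mul_le_mul h3 (by linarith [Real.exp_pos 1]) ht (Real.exp_pos s).le
      rw [← Real.exp_add, ← two_mul] at h4
      linarith
  · set r := 1 + 1 / (q - 1) with hr
    have hq1 : 0 < q - 1 := by linarith
    have hr0 : 0 < r := by positivity
    refine ⟨1 + r ^ r, by positivity, fun s t hs ht => ?_⟩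
    have hl := hlog t ht
    have hlb : 1 ≤ Real.log (Real.exp 1 + t) ^ b := Real.one_le_rpow hl hb
    have hΦ : 0 ≤ t ^ q * Real.log (Real.exp 1 + t) ^ b := by positivity
    have hrr : 0 ≤ r ^ r := by positivity
    have he := Real.exp_pos (2 * s)
    rcases le_or_gt s (t ^ (q - 1)) with h2 | h2
    · have h3 : s * t ≤ t ^ q := by
        rcases ht.eq_or_lt with h0 | h0
        · rw [← h0]; simp; positivity
        · calc s * t ≤ t ^ (q - 1) * t := mul_le_mul_of_nonneg_right h2 ht
            _ = t ^ q := by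
              conv_lhs => rw [← Real.rpow_one t]
              rw [← Real.rpow_mul ht, ← Real.rpow_add h0]; congr 1; ring
      have h4 : t ^ q ≤ t ^ q * Real.log (Real.exp 1 + t) ^ b :=
        le_mul_of_one_le_right (by positivity) hlb
      nlinarith [mul_nonneg hrr hΦ, mul_nonneg hrr he.le]
    · have hs0 : 0 < s := lt_of_le_of_lt (by positivity) h2
      have h3 : t ≤ s ^ (1 / (q - 1)) := by
        have := Real.rpow_le_rpow (by positivity) h2.le (show 0 ≤ 1 / (q - 1) by positivity)
        rw [← Real.rpow_mul ht, mul_one_div_cancel hq1.ne', Real.rpow_one] at this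
        exact this
      have h4 : s * t ≤ s ^ r := by
        calc s * t ≤ s * s ^ (1 / (q - 1)) := mul_le_mul_of_nonneg_left h3 hs
          _ = s ^ r := by rw [hr, Real.rpow_add hs0, Real.rpow_one]
      have h5 : s ^ r ≤ r ^ r * Real.exp s := by
        have h6 : s / r ≤ Real.exp (s / r) := by linarith [Real.add_one_le_exp (s / r)]
        have h7 := Real.rpow_le_rpow (by positivity) h6 hr0.le
        rw [Real.div_rpow hs hr0.le, ← Real.exp_mul, div_mul_cancel₀ _ hr0.ne',
          div_le_iff₀ (by positivity)] at h7
        linarith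
      have h8 : Real.exp s ≤ Real.exp (2 * s) := Real.exp_le_exp.2 (by linarith)
      have h9 := mul_le_mul_of_nonneg_left h8 hrr
      nlinarith [mul_nonneg hrr hΦ]

theorem ee_tail (y s α : ℝ) (hs : 0 < s) (hα : 1 < α) :
    ∫⁻ x in {x : ℝ | s < |x - y|}, ENNReal.ofReal (|x - y| ^ (-α)) ≤
      ENNReal.ofReal (2 * (s ^ (1 - α) / (α - 1))) := by
  have hms : MeasurableSet {x : ℝ | s < |x - y|} :=
    measurableSet_lt measurable_const (by fun_prop)
  have hms0 : MeasurableSet {x : ℝ | s < |x|} :=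
    measurableSet_lt measurable_const (by fun_prop)
  have e0 : ∫⁻ x in Ioi s, ENNReal.ofReal (|x| ^ (-α)) = ENNReal.ofReal (s ^ (1 - α) / (α - 1)) := by
    have : ∫⁻ x in Ioi s, ENNReal.ofReal (|x| ^ (-α)) = ∫⁻ x in Ioi s, ENNReal.ofReal (x ^ (-α)) := by
      apply setLIntegral_congr_fun measurableSet_Ioi
      intro x hx
      have : 0 < x := hs.trans hx
      simp only [abs_of_pos this]
    rw [this, ← ofReal_integral_eq_lintegral_ofReal (integrableOn_Ioi_rpow_of_lt (by linarith) hs)]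
    · rw [integral_Ioi_rpow_of_lt (by linarith) hs]
      congr 1
      rw [neg_add_eq_sub]
      rw [neg_div, ← div_neg]; congr 1; ring
    · filter_upwards [ae_restrict_mem measurableSet_Ioi] with x hx
      have : 0 < x := hs.trans hx
      exact Real.rpow_nonneg this.le _
  have e1 : ∫⁻ x in Iio (-s), ENNReal.ofReal (|x| ^ (-α)) =
      ∫⁻ x in Ioi s, ENNReal.ofReal (|x| ^ (-α)) := by
    rw [← lintegral_indicator measurableSet_Iio, ← lintegral_indicator measurableSet_Ioi,
      ← lintegral_neg_eq_self (μ := (volume : Measure ℝ))]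
    congr 1; ext x
    by_cases hx : s < x
    · rw [indicator_of_mem (by simpa using hx), indicator_of_mem (by simpa using hx), abs_neg]
    · rw [indicator_of_notMem (by simpa using hx), indicator_of_notMem (by simpa using hx)]
  calc ∫⁻ x in {x : ℝ | s < |x - y|}, ENNReal.ofReal (|x - y| ^ (-α))
      = ∫⁻ x, ({x : ℝ | s < |x|}.indicator (fun x => ENNReal.ofReal (|x| ^ (-α)))) (x - y) := by
        rw [← lintegral_indicator hms]; rfl
    _ = ∫⁻ x in {x : ℝ | s < |x|}, ENNReal.ofReal (|x| ^ (-α)) := by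
        rw [lintegral_sub_right_eq_self, lintegral_indicator hms0]
    _ ≤ ∫⁻ x in Ioi s ∪ Iio (-s), ENNReal.ofReal (|x| ^ (-α)) := by
        apply lintegral_mono_set
        intro x hx
        have hx2 : s < |x| := hx
        rcases lt_abs.1 hx2 with h | h
        · exact Or.inl h
        · right; simp; linarith
    _ ≤ _ := by
        refine (lintegral_union_le _ _ _).trans ?_
        rw [e1, e0, ← two_mul, ENNReal.ofReal_mul (by norm_num)]
        simp

namespace eeBMO
variable {A A' : ℝ → ℝ} {M : ℝ}

theorem growth (h : eeBMO A A' M) : ∃ K : ℝ, 0 < K ∧ ∀ u c d v : ℝ, c < d → u ≤ c → d ≤ v →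
    |eeSl A u v - eeSl A c d| ≤ K * Real.sqrt ((v - u) / (d - c)) := by
  obtain ⟨κ, hκ, hj⟩ := h.jn_exp
  refine ⟨1 + 14 / κ ^ 2, by positivity, fun u c d v hcd huc hdv => ?_⟩
  have huv : u < v := by linarith
  have hs : 0 < d - c := by linarith
  have hL : 0 < v - u := by linarith
  set R := Real.sqrt ((v - u) / (d - c)) with hR
  have hR0 : 0 < R := Real.sqrt_pos.2 (by positivity)
  have hR2 : R * R * (d - c) = v - u := by
    rw [Real.mul_self_sqrt (by positivity)]; field_simp
  have hpt : ∀ t : ℝ, 0 ≤ t → t ≤ R + (2 / (κ ^ 2 * R)) * Real.exp (κ * t) := by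
    intro t ht
    have h1 := Real.quadratic_le_exp_of_nonneg (x := κ * t) (by positivity)
    have h2 : t ≤ R + t ^ 2 / R := by
      rcases le_or_gt t R with h3 | h3
      · have : 0 ≤ t ^ 2 / R := by positivity
        linarith
      · have : t ≤ t ^ 2 / R := by rw [le_div_iff₀ hR0]; nlinarith
        linarith
    have h3 : t ^ 2 / R ≤ (2 / (κ ^ 2 * R)) * Real.exp (κ * t) := by
      rw [div_mul_eq_mul_div, div_le_div_iff₀ hR0 (by positivity)]
      have : κ ^ 2 * t ^ 2 ≤ 2 * Real.exp (κ * t) := by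
        have : 0 ≤ κ * t := by positivity
        nlinarith
      nlinarith
    linarith
  have h1 := h.slope_le hcd le_rfl le_rfl (eeSl A u v)
  have h2 : ENNReal.ofReal (|eeSl A c d - eeSl A u v| * (d - c)) ≤
      ENNReal.ofReal (R * (d - c) + (2 / (κ ^ 2 * R)) * (7 * (v - u))) := by
    calc ENNReal.ofReal (|eeSl A c d - eeSl A u v| * (d - c))
        ≤ ENNReal.ofReal (∫ y in Ioc c d, |A' y - eeSl A u v|) := ENNReal.ofReal_le_ofReal h1
      _ = ∫⁻ y in Ioc c d, ENNReal.ofReal |A' y - eeSl A u v| :=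
          ofReal_integral_eq_lintegral_ofReal (h.ionk _ _ _) (Eventually.of_forall fun _ => abs_nonneg _)
      _ ≤ ∫⁻ y in Ioc c d, (ENNReal.ofReal R + ENNReal.ofReal (2 / (κ ^ 2 * R)) *
            ENNReal.ofReal (Real.exp (κ * |A' y - eeSl A u v|))) := by
          apply lintegral_mono
          intro y
          dsimp only
          rw [← ENNReal.ofReal_mul (by positivity), ← ENNReal.ofReal_add (by positivity) (by positivity)]
          exact ENNReal.ofReal_le_ofReal (hpt _ (abs_nonneg _))
      _ = ENNReal.ofReal (R * (d - c)) + ENNReal.ofReal (2 / (κ ^ 2 * R)) *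
            ∫⁻ y in Ioc c d, ENNReal.ofReal (Real.exp (κ * |A' y - eeSl A u v|)) := by
          rw [lintegral_add_left measurable_const, lintegral_const_mul' _ _ ENNReal.ofReal_ne_top]
          congr 1
          simp [ENNReal.ofReal_mul hR0.le]
      _ ≤ ENNReal.ofReal (R * (d - c)) + ENNReal.ofReal (2 / (κ ^ 2 * R)) *
            ENNReal.ofReal (7 * (v - u)) := by
          gcongr
          exact (lintegral_mono_set (Ioc_subset_Ioc huc hdv)).trans (hj u v huv)
      _ = _ := by
          rw [← ENNReal.ofReal_mul (by positivity), ← ENNReal.ofReal_add (by positivity) (by positivity)]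
  rw [ENNReal.ofReal_le_ofReal_iff (by positivity)] at h2
  rw [abs_sub_comm]
  have h3 : R * (d - c) + (2 / (κ ^ 2 * R)) * (7 * (v - u)) = (1 + 14 / κ ^ 2) * R * (d - c) := by
    rw [← hR2]; field_simp; ring
  rw [h3] at h2
  exact le_of_mul_le_mul_right h2 hs

theorem P2_le (h : eeBMO A A' M) : ∃ K : ℝ, 0 < K ∧ ∀ c d x y : ℝ, y ∈ Ioo c d →
    x ∉ Ioo (2 * c - d) (2 * d - c) →
    |P2 A A' x y| ≤ K * |x - y| * Real.sqrt (|x - y| / (d - c)) + |A' y - eeSl A c d| * |x - y| := by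
  obtain ⟨K, hK, hg⟩ := h.growth
  have hM := h.pos
  refine ⟨2 * (M + 2 * K), by positivity, fun c d x y hy hx => ?_⟩
  have hcd : c < d := hy.1.trans hy.2
  have hs : 0 < d - c := by linarith
  set k := eeSl A c d with hk
  have e1 : P2 A A' x y = (A x - A y - k * (x - y)) - (A' y - k) * (x - y) := by
    rw [P2]; ring
  -- the hull
  have main : ∀ u v : ℝ, u ≤ c → d ≤ v → v - u ≤ 2 * |x - y| → d - c ≤ |x - y| →
      |A x - A y - k * (x - y)| ≤ ∫ t in Ioc u v, |A' t - k| →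
      |A x - A y - k * (x - y)| ≤ 2 * (M + 2 * K) * |x - y| * Real.sqrt (|x - y| / (d - c)) := by
    intro u v hu hv hL hr hle
    have huv : u < v := by linarith
    refine hle.trans ((h.int_le huv k).trans ?_)
    have h1 := hg u c d v hcd hu hv
    set r := |x - y|
    have hr0 : 0 < r := by linarith
    set T := Real.sqrt (r / (d - c)) with hT
    have hT1 : 1 ≤ T := by
      rw [hT, Real.one_le_sqrt, one_le_div hs]; exact hr
    have hT2 : Real.sqrt ((v - u) / (d - c)) ≤ 2 * T := by
      rw [hT, Real.sqrt_le_left (by positivity), mul_pow, Real.sq_sqrt (by positivity),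
        ← mul_div_assoc]
      gcongr; linarith
    have h2 : M + |eeSl A u v - k| ≤ (M + 2 * K) * T := by nlinarith
    calc (v - u) * (M + |eeSl A u v - k|) ≤ (2 * r) * ((M + 2 * K) * T) :=
          mul_le_mul hL h2 (by positivity) (by positivity)
      _ = _ := by ring
  have first : |A x - A y - k * (x - y)| ≤
      2 * (M + 2 * K) * |x - y| * Real.sqrt (|x - y| / (d - c)) := by
    rw [mem_Ioo, not_and_or, not_lt, not_lt] at hx
    rcases hx with hx | hx
    · have hyx : x < y := by linarith [hy.1]
      have hab : |x - y| = y - x := by rw [abs_of_neg (by linarith)]; ring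
      refine main x d (by linarith) le_rfl (by rw [hab]; linarith [hy.1]) (by rw [hab]; linarith [hy.1]) ?_
      refine le_trans (le_of_eq ?_) (h.slope_le hyx le_rfl hy.2.le k)
      rw [← abs_of_pos (show 0 < y - x by linarith), ← abs_mul, eeSl, ← abs_neg]
      try rw [abs_of_pos (show 0 < y - x by linarith)]
      congr 1
      have : y - x ≠ 0 := by intro h; linarith
      field_simp; ring
    · have hyx : y < x := by linarith [hy.2]
      have hab : |x - y| = x - y := by rw [abs_of_pos (by linarith)]
      refine main c x le_rfl (by linarith) (by rw [hab]; linarith [hy.2]) (by rw [hab]; linarith [hy.2]) ?_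
      refine le_trans (le_of_eq ?_) (h.slope_le hyx hy.1.le le_rfl k)
      rw [← abs_of_pos (show 0 < x - y by linarith), ← abs_mul, eeSl, abs_of_pos (show 0 < x - y by linarith)]
      congr 1
      have : x - y ≠ 0 := by intro h; linarith
      field_simp
  rw [e1]
  refine (abs_sub _ _).trans ?_
  rw [abs_mul]
  linarith

theorem ker_int (h : eeBMO A A' M) : ∃ K : ℝ, 0 < K ∧ ∀ c d y : ℝ, y ∈ Ioo c d →
    ∫⁻ x in (Ioo (2 * c - d) (2 * d - c))ᶜ, ENNReal.ofReal (|P2 A A' x y| / |x - y| ^ 3) ≤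
      ENNReal.ofReal ((K + 2 * |A' y - eeSl A c d|) / (d - c)) := by
  obtain ⟨K, hK, hP⟩ := h.P2_le
  refine ⟨4 * K, by positivity, fun c d y hy => ?_⟩
  have hcd : c < d := hy.1.trans hy.2
  set s := d - c with hsdef
  have hs : 0 < s := by linarith
  set D := |A' y - eeSl A c d| with hD
  have hD0 : 0 ≤ D := abs_nonneg _
  have hsub : (Ioo (2 * c - d) (2 * d - c))ᶜ ⊆ {x : ℝ | s < |x - y|} := by
    intro x hx
    rw [mem_compl_iff, mem_Ioo, not_and_or, not_lt, not_lt] at hx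
    rcases hx with hx | hx
    · have : s < |x - y| := lt_abs.2 (Or.inr (by linarith [hy.1]))
      exact this
    · have : s < |x - y| := lt_abs.2 (Or.inl (by linarith [hy.2]))
      exact this
  have hpt : ∀ x ∈ (Ioo (2 * c - d) (2 * d - c))ᶜ, ENNReal.ofReal (|P2 A A' x y| / |x - y| ^ 3) ≤
      ENNReal.ofReal (K * s ^ (-(1/2) : ℝ)) * ENNReal.ofReal (|x - y| ^ (-(3/2) : ℝ)) +
        ENNReal.ofReal D * ENNReal.ofReal (|x - y| ^ (-2 : ℝ)) := by
    intro x hx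
    have h1 := hP c d x y hy hx
    have hr : 0 < |x - y| := hs.trans (hsub hx)
    set r := |x - y|
    rw [← ENNReal.ofReal_mul (by positivity), ← ENNReal.ofReal_mul (by positivity),
      ← ENNReal.ofReal_add (by positivity) (by positivity)]
    apply ENNReal.ofReal_le_ofReal
    rw [div_le_iff₀ (by positivity)]
    refine h1.trans (le_of_eq ?_)
    have e1 : Real.sqrt (r / s) = r ^ (1/2 : ℝ) * s ^ (-(1/2) : ℝ) := by
      rw [Real.sqrt_eq_rpow, Real.div_rpow hr.le hs.le, Real.rpow_neg hs.le]; rfl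
    have e2 : r ^ (-2 : ℝ) * r ^ 3 = r := by
      rw [← Real.rpow_natCast, ← Real.rpow_add hr]; norm_num
    have e3 : r ^ (-(3/2) : ℝ) * r ^ 3 = r * r ^ (1/2 : ℝ) := by
      rw [← Real.rpow_natCast, ← Real.rpow_add hr]
      conv_rhs => rw [← Real.rpow_one r]
      rw [← Real.rpow_mul hr.le, ← Real.rpow_add hr]; norm_num
    rw [e1, add_mul]
    congr 1
    · calc K * r * (r ^ (1/2 : ℝ) * s ^ (-(1/2) : ℝ)) = K * s ^ (-(1/2) : ℝ) * (r * r ^ (1/2 : ℝ)) := by ring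
        _ = _ := by rw [← e3]; ring
    · rw [mul_assoc, e2]
  calc ∫⁻ x in (Ioo (2 * c - d) (2 * d - c))ᶜ, ENNReal.ofReal (|P2 A A' x y| / |x - y| ^ 3)
      ≤ ∫⁻ x in (Ioo (2 * c - d) (2 * d - c))ᶜ,
        (ENNReal.ofReal (K * s ^ (-(1/2) : ℝ)) * ENNReal.ofReal (|x - y| ^ (-(3/2) : ℝ)) +
        ENNReal.ofReal D * ENNReal.ofReal (|x - y| ^ (-2 : ℝ))) :=
        setLIntegral_mono' measurableSet_Ioo.compl hpt
    _ ≤ ∫⁻ x in {x : ℝ | s < |x - y|},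
        (ENNReal.ofReal (K * s ^ (-(1/2) : ℝ)) * ENNReal.ofReal (|x - y| ^ (-(3/2) : ℝ)) +
        ENNReal.ofReal D * ENNReal.ofReal (|x - y| ^ (-2 : ℝ))) := lintegral_mono_set hsub
    _ = ENNReal.ofReal (K * s ^ (-(1/2) : ℝ)) *
          (∫⁻ x in {x : ℝ | s < |x - y|}, ENNReal.ofReal (|x - y| ^ (-(3/2) : ℝ))) +
        ENNReal.ofReal D * ∫⁻ x in {x : ℝ | s < |x - y|}, ENNReal.ofReal (|x - y| ^ (-2 : ℝ)) := by
        rw [lintegral_add_left (by fun_prop), lintegral_const_mul' _ _ ENNReal.ofReal_ne_top,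
          lintegral_const_mul' _ _ ENNReal.ofReal_ne_top]
    _ ≤ ENNReal.ofReal (K * s ^ (-(1/2) : ℝ)) * ENNReal.ofReal (2 * (s ^ (1 - 3/2 : ℝ) / (3/2 - 1))) +
        ENNReal.ofReal D * ENNReal.ofReal (2 * (s ^ (1 - 2 : ℝ) / (2 - 1))) := by
        gcongr
        · exact ee_tail y s (3/2) hs (by norm_num)
        · exact ee_tail y s 2 hs (by norm_num)
    _ = _ := by
        rw [← ENNReal.ofReal_mul (by positivity), ← ENNReal.ofReal_mul (by positivity),
          ← ENNReal.ofReal_add (by positivity) (by norm_num; positivity)]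
        congr 1
        have e1 : s ^ (1 - 2 : ℝ) = s⁻¹ := by norm_num [Real.rpow_neg_one]
        have e2 : s ^ (-(1/2) : ℝ) * s ^ (1 - 3/2 : ℝ) = s⁻¹ := by
          rw [← Real.rpow_add hs, ← Real.rpow_neg_one]; norm_num
        rw [e1]
        calc K * s ^ (-(1/2) : ℝ) * (2 * (s ^ (1 - 3/2 : ℝ) / (3/2 - 1))) + D * (2 * (s⁻¹ / (2 - 1)))
            = 4 * K * (s ^ (-(1/2) : ℝ) * s ^ (1 - 3/2 : ℝ)) + 2 * D * s⁻¹ := by ring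
          _ = _ := by rw [e2]; field_simp

theorem f_int (h : eeBMO A A' M) (q b K0 : ℝ) (hq : 1 ≤ q) (hb : 0 ≤ b) (hqb : q = 1 → 1 ≤ b)
    (hK0 : 0 < K0) :
    ∃ K : ℝ, 0 < K ∧ ∀ (c d : ℝ) (f : ℝ → ℝ), c < d → 
    ∫⁻ y in Ioo c d, ENNReal.ofReal (|f y| * (K0 + 2 * |A' y - eeSl A c d|)) ≤
      ENNReal.ofReal K * (ENNReal.ofReal (d - c) +
        ∫⁻ y in Ioo c d, ENNReal.ofReal (|f y| ^ q * Real.log (Real.exp 1 + |f y|) ^ b)) := by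
  obtain ⟨κ, hκ, hj⟩ := h.jn_exp
  obtain ⟨Y, hY, hyg⟩ := ee_young q b hq hb hqb
  have he := Real.exp_pos 2
  set K' := (4 / κ) * Y + K0 * Y * (1 + Real.exp 2) with hK'
  have hK'0 : 0 < K' := by positivity
  refine ⟨7 * K', by positivity, fun c d f hcd => ?_⟩
  have hs : 0 < d - c := by linarith
  set Φ : ℝ → ℝ := fun t => |t| ^ q * Real.log (Real.exp 1 + |t|) ^ b with hΦ
  have hΦ0 : ∀ t, 0 ≤ Φ t := by
    intro t
    have : 0 ≤ Real.log (Real.exp 1 + |t|) := Real.log_nonneg (by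
      have := Real.add_one_le_exp 1; have := abs_nonneg t; linarith)
    positivity
  have hpt : ∀ y, ENNReal.ofReal (|f y| * (K0 + 2 * |A' y - eeSl A c d|)) ≤
      ENNReal.ofReal K' * (ENNReal.ofReal (Real.exp (κ * |A' y - eeSl A c d|)) +
        ENNReal.ofReal (Φ (f y))) := by
    intro y
    have h0 := hΦ0 (f y)
    set D := |A' y - eeSl A c d| with hD
    have hD0 : 0 ≤ D := abs_nonneg _
    rw [← ENNReal.ofReal_add (by positivity) h0, ← ENNReal.ofReal_mul hK'0.le]
    apply ENNReal.ofReal_le_ofReal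
    have h1 := hyg (κ * D / 2) (|f y|) (by positivity) (abs_nonneg _)
    have h2 := hyg 1 (|f y|) zero_le_one (abs_nonneg _)
    have e1 : 2 * (κ * D / 2) = κ * D := by ring
    rw [e1] at h1
    rw [one_mul, mul_one] at h2
    change _ ≤ Y * (Real.exp (κ * D) + Φ (f y)) at h1
    change _ ≤ Y * (Real.exp 2 + Φ (f y)) at h2
    have hE : 1 ≤ Real.exp (κ * D) := Real.one_le_exp (by positivity)
    set X := Real.exp (κ * D)
    have h3 : |f y| * (2 * D) ≤ (4 / κ) * Y * (X + Φ (f y)) := by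
      calc |f y| * (2 * D) = (4 / κ) * (κ * D / 2 * |f y|) := by field_simp; ring
        _ ≤ (4 / κ) * (Y * (X + Φ (f y))) := mul_le_mul_of_nonneg_left h1 (by positivity)
        _ = _ := by ring
    have h4 : |f y| * K0 ≤ K0 * Y * (1 + Real.exp 2) * (X + Φ (f y)) := by
      calc |f y| * K0 = K0 * |f y| := by ring
        _ ≤ K0 * (Y * (Real.exp 2 + Φ (f y))) := mul_le_mul_of_nonneg_left h2 hK0.le
        _ ≤ K0 * (Y * ((1 + Real.exp 2) * (X + Φ (f y)))) := by
          gcongr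
          nlinarith
        _ = _ := by ring
    rw [hK']; linarith
  calc ∫⁻ y in Ioo c d, ENNReal.ofReal (|f y| * (K0 + 2 * |A' y - eeSl A c d|))
      ≤ ∫⁻ y in Ioo c d, ENNReal.ofReal K' * (ENNReal.ofReal (Real.exp (κ * |A' y - eeSl A c d|)) +
        ENNReal.ofReal (Φ (f y))) := lintegral_mono hpt
    _ = ENNReal.ofReal K' * ((∫⁻ y in Ioo c d, ENNReal.ofReal (Real.exp (κ * |A' y - eeSl A c d|))) +
        ∫⁻ y in Ioo c d, ENNReal.ofReal (Φ (f y))) := by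
        have := h.meas
        rw [lintegral_const_mul' _ _ ENNReal.ofReal_ne_top, lintegral_add_left (by fun_prop)]
    _ ≤ ENNReal.ofReal K' * (ENNReal.ofReal 7 * ENNReal.ofReal (d - c) +
        ENNReal.ofReal 7 * ∫⁻ y in Ioo c d, ENNReal.ofReal (Φ (f y))) := by
        gcongr
        · rw [← ENNReal.ofReal_mul (by norm_num)]
          exact (lintegral_mono_set Ioo_subset_Ioc_self).trans (hj c d hcd)
        · exact le_mul_of_one_le_left (by positivity) (by norm_num)
    _ = _ := by
        rw [← mul_add, ← mul_assoc, ← ENNReal.ofReal_mul hK'0.le, mul_comm K']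

end eeBMO


theorem ee_cz1 (S : Set (ℝ × ℝ)) (hSc : S.Countable) (hlt : ∀ I ∈ S, I.1 < I.2)
    (hend : ∀ I ∈ S, I.1 ∉ (⋃ J ∈ S, Ioo J.1 J.2) ∧ I.2 ∉ (⋃ J ∈ S, Ioo J.1 J.2))
    (hdisj : S.PairwiseDisjoint (fun I => Ioo I.1 I.2))
    (a : ℝ → ℝ) (ha : Measurable a) (p q : ℝ) (hp : 1 ≤ p) (hpq : p ≤ q)
    (hIntg : Integrable (fun t => |a t| ^ p))
    (hI : ∀ I ∈ S, ∫ t in I.1..I.2, |a t| ^ p ≤ I.2 - I.1)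
    (hoff : ∀ᵐ x, x ∉ (⋃ J ∈ S, Ioo J.1 J.2) → |a x| ≤ 1) :
    LocallyIntegrable a ∧ ∃ g : ℝ → ℝ, Measurable g ∧ LocallyIntegrable g ∧
      (∀ x y, |Adiff g x y| ≤ |x - y|) ∧
      (∫⁻ y, ENNReal.ofReal (|g y| ^ q) ≤
        (∫⁻ y, ENNReal.ofReal (|a y| ^ p)) + volume (⋃ J ∈ S, Ioo J.1 J.2)) ∧
      (∀ x y, x ∉ (⋃ J ∈ S, Ioo J.1 J.2) → y ∉ (⋃ J ∈ S, Ioo J.1 J.2) →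
        Adiff a x y = Adiff g x y) ∧
      (∀ x, x ∉ (⋃ J ∈ S, Ioo J.1 J.2) → ∀ I ∈ S, ∀ y ∈ Ioo I.1 I.2,
        |Adiff a x y - Adiff g x y| ≤ 2 * (I.2 - I.1)) := by
  set Ω := ⋃ J ∈ S, Ioo J.1 J.2 with hΩ
  have hΩo : IsOpen Ω := isOpen_biUnion fun _ _ => isOpen_Ioo
  have hΩm : MeasurableSet Ω := hΩo.measurableSet
  have hber : ∀ x, |a x| ≤ 1 + (|a x| ^ p - 1) / p := by
    intro x
    have h1 := one_add_mul_self_le_rpow_one_add (s := |a x| - 1) (by linarith [abs_nonneg (a x)]) hp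
    rw [add_sub_cancel] at h1
    have hp0 : 0 < p := by linarith
    rw [← sub_le_iff_le_add', le_div_iff₀ hp0]
    linarith
  have hfinint : ∀ u v : ℝ, IntegrableOn a (Ioc u v) := by
    intro u v
    refine Integrable.mono' (g := fun x => 1 + (|a x| ^ p - 1) / p) ?_ ha.aestronglyMeasurable
      (Eventually.of_forall fun x => by simpa using hber x)
    exact (integrable_const _).add ((hIntg.integrableOn.sub (integrable_const _)).div_const _)
  have hli : ∀ b : ℝ → ℝ, (∀ u v, IntegrableOn b (Ioc u v)) → LocallyIntegrable b := by
    intro b hb x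
    exact ⟨Ioc (x - 1) (x + 1), Ioc_mem_nhds (by linarith) (by linarith), hb _ _⟩
  have hIabs : ∀ I ∈ S, ∫ t in I.1..I.2, |a t| ≤ I.2 - I.1 := by
    intro I hIS
    have hl := hlt I hIS
    have hii : IntervalIntegrable (fun t => |a t| ^ p) volume I.1 I.2 := hIntg.intervalIntegrable
    have h1 : ∫ t in I.1..I.2, |a t| ≤ ∫ t in I.1..I.2, (1 + (|a t| ^ p - 1) / p) := by
      apply intervalIntegral.integral_mono_on hl.le
      · exact ((intervalIntegrable_iff_integrableOn_Ioc_of_le hl.le).2 (hfinint _ _)).abs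
      · exact (intervalIntegrable_const).add ((hii.sub intervalIntegrable_const).div_const _)
      · intro x _; exact hber x
    rw [intervalIntegral.integral_add intervalIntegrable_const
      ((hii.sub intervalIntegrable_const).div_const _), intervalIntegral.integral_div,
      intervalIntegral.integral_sub hii intervalIntegrable_const] at h1
    simp at h1
    have h2 := hI I hIS
    have : ((∫ t in I.1..I.2, |a t| ^ p) - (I.2 - I.1)) / p ≤ 0 :=
      div_nonpos_of_nonpos_of_nonneg (by linarith) (by linarith)
    linarith
  -- the good function
  haveI : Countable S := hSc.to_subtype
  obtain ⟨g, hgm, hg⟩ := exists_measurable_piecewise (ι := Option S)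
    (fun o => o.elim Ωᶜ (fun I => Ioo I.1.1 I.1.2))
    (by rintro (_ | I)
        · exact hΩm.compl
        · exact measurableSet_Ioo)
    (fun o => o.elim a (fun I => fun _ => (∫ t in I.1.1..I.1.2, a t) / (I.1.2 - I.1.1)))
    (by rintro (_ | I)
        · exact ha
        · exact measurable_const)
    (by rintro (_ | I) (_ | J) hne x hx
        · rfl
        · exact absurd (mem_biUnion J.2 hx.2) hx.1
        · exact absurd (mem_biUnion I.2 hx.1) hx.2
        · exfalso
          have hIJ : (I : ℝ × ℝ) ≠ J := fun h => hne (by rw [Subtype.ext h])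
          exact disjoint_left.1 (hdisj I.2 J.2 hIJ) hx.1 hx.2)
  have hgoff : ∀ x ∉ Ω, g x = a x := fun x hx => hg none hx
  have hgon : ∀ I ∈ S, ∀ x ∈ Ioo I.1 I.2, g x = (∫ t in I.1..I.2, a t) / (I.2 - I.1) :=
    fun I hI x hx => hg (some ⟨I, hI⟩) hx
  have hmean : ∀ I ∈ S, |(∫ t in I.1..I.2, a t) / (I.2 - I.1)| ≤ 1 := by
    intro I hIS
    have hl := hlt I hIS
    rw [abs_div, abs_of_pos (by linarith : 0 < I.2 - I.1), div_le_one (by linarith)]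
    exact (intervalIntegral.abs_integral_le_integral_abs hl.le).trans (hIabs I hIS)
  have hg1on : ∀ x ∈ Ω, |g x| ≤ 1 := by
    intro x hx
    obtain ⟨I, hIS, hxI⟩ := mem_iUnion₂.1 hx
    rw [hgon I hIS x hxI]; exact hmean I hIS
  have hg1 : ∀ᵐ x, |g x| ≤ 1 := by
    filter_upwards [hoff] with x hx
    by_cases h : x ∈ Ω
    · exact hg1on x h
    · rw [hgoff x h]; exact hx h
  have hgi : ∀ u v : ℝ, IntegrableOn g (Ioc u v) := by
    intro u v
    exact Integrable.mono' (integrable_const (1:ℝ)) hgm.aestronglyMeasurable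
      (ae_restrict_of_ae hg1)
  have aii : ∀ u v, IntervalIntegrable a volume u v := fun u v => ⟨hfinint _ _, hfinint _ _⟩
  have gii : ∀ u v, IntervalIntegrable g volume u v := fun u v => ⟨hgi _ _, hgi _ _⟩
  have hIooz : ∀ I ∈ S, ∫ t in Ioo I.1 I.2, (a t - g t) = 0 := by
    intro I hIS
    have hl := hlt I hIS
    have h1 : ∫ t in Ioo I.1 I.2, (a t - g t) =
        (∫ t in Ioo I.1 I.2, a t) - ∫ t in Ioo I.1 I.2, g t :=
      integral_sub ((hfinint _ _).mono_set Ioo_subset_Ioc_self)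
        ((hgi _ _).mono_set Ioo_subset_Ioc_self)
    have h2 : ∫ t in Ioo I.1 I.2, g t = ∫ t in Ioo I.1 I.2, (∫ t in I.1..I.2, a t) / (I.2 - I.1) :=
      setIntegral_congr_fun measurableSet_Ioo (fun x hx => hgon I hIS x hx)
    rw [h1, h2, setIntegral_const, Real.volume_real_Ioo_of_le hl.le, smul_eq_mul,
      mul_div_cancel₀ _ (by linarith : I.2 - I.1 ≠ 0),
      intervalIntegral.integral_of_le hl.le, integral_Ioc_eq_integral_Ioo, sub_self]
  have hz0 : ∀ u v, u ≤ v → u ∉ Ω → v ∉ Ω → ∫ t in u..v, (a t - g t) = 0 := by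
    intro u v huv hu hv
    rw [intervalIntegral.integral_of_le huv]
    have e : ∫ t in Ioc u v, (a t - g t) =
        ∫ t in ⋃ I : S, (Ioc u v ∩ Ioo I.1.1 I.1.2), (a t - g t) := by
      apply setIntegral_eq_of_subset_of_forall_sdiff_eq_zero measurableSet_Ioc
      · exact iUnion_subset fun I => inter_subset_left
      · rintro x ⟨hx, hx2⟩
        have : x ∉ Ω := by
          intro hxΩ
          obtain ⟨I, hIS, hxI⟩ := mem_iUnion₂.1 hxΩ
          exact hx2 (mem_iUnion.2 ⟨⟨I, hIS⟩, hx, hxI⟩)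
        rw [hgoff x this, sub_self]
    rw [e, integral_iUnion (fun I => measurableSet_Ioc.inter measurableSet_Ioo)]
    · rw [← tsum_zero (β := S)]
      congr 1; funext I
      have hIS := I.2
      have hl := hlt _ hIS
      have hu' : u ∉ Ioo I.1.1 I.1.2 := fun h => hu (mem_biUnion hIS h)
      have hv' : v ∉ Ioo I.1.1 I.1.2 := fun h => hv (mem_biUnion hIS h)
      by_cases hc : u ≤ I.1.1 ∧ I.1.2 ≤ v
      · have hsub : Ioo I.1.1 I.1.2 ⊆ Ioc u v :=
          fun x hx => ⟨lt_of_le_of_lt hc.1 hx.1, (hx.2.le.trans hc.2)⟩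
        rw [inter_eq_right.2 hsub]
        exact hIooz _ hIS
      · have : Ioc u v ∩ Ioo I.1.1 I.1.2 = ∅ := by
          ext x; simp only [mem_inter_iff, mem_Ioc, mem_Ioo, mem_empty_iff_false, iff_false]
          rintro ⟨⟨h1, h2⟩, h3, h4⟩
          apply hc
          constructor
          · by_contra h; push Not at h; exact hu' ⟨h, by linarith⟩
          · by_contra h; push Not at h; exact hv' ⟨by linarith, h⟩
        rw [this]; simp
    · intro I J hIJ
      have : (I : ℝ × ℝ) ≠ J := fun h => hIJ (Subtype.ext h)
      exact (hdisj I.2 J.2 this).mono inter_subset_right inter_subset_right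
    · exact ((hfinint u v).sub (hgi u v)).mono_set (iUnion_subset fun I => inter_subset_left)
  have hz : ∀ u v, u ∉ Ω → v ∉ Ω → ∫ t in u..v, (a t - g t) = 0 := by
    intro u v hu hv
    rcases le_total u v with h | h
    · exact hz0 u v h hu hv
    · rw [intervalIntegral.integral_symm, hz0 v u h hv hu, neg_zero]
  have hAd : ∀ x y, Adiff a x y - Adiff g x y = ∫ t in y..x, (a t - g t) := by
    intro x y
    rw [Adiff, Adiff, intervalIntegral.integral_sub (aii _ _) (gii _ _)]
  refine ⟨hli a hfinint, g, hgm, hli g hgi, ?_, ?_, ?_, ?_⟩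
  · intro x y
    have := intervalIntegral.norm_integral_le_of_norm_le_const_ae (a := y) (b := x) (C := 1) (f := g)
      (by filter_upwards [hg1] with t ht _ using by simpa using ht)
    simpa [Adiff] using this
  · rw [← lintegral_add_compl _ hΩm, add_comm]
    refine add_le_add ?_ ?_
    · refine le_trans ?_ (setLIntegral_le_lintegral Ωᶜ _)
      refine setLIntegral_mono_ae' hΩm.compl ?_
      filter_upwards [hoff] with x hx hxc
      apply ENNReal.ofReal_le_ofReal
      rw [hgoff x hxc]
      rcases eq_or_lt_of_le (abs_nonneg (a x)) with h0 | h0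
      · rw [← h0, Real.zero_rpow (by linarith), Real.zero_rpow (by linarith)]
      · exact Real.rpow_le_rpow_of_exponent_ge h0 (hx hxc) hpq
    · refine (setLIntegral_mono' (g := fun _ => 1) hΩm ?_).trans (by simp)
      intro x hx
      rw [← ENNReal.ofReal_one]
      exact ENNReal.ofReal_le_ofReal (Real.rpow_le_one (abs_nonneg _) (hg1on x hx) (by linarith))
  · intro x y hx hy
    rw [← sub_eq_zero, hAd, hz y x hy hx]
  · intro x hx I hIS y hy
    have bii : ∀ u v, IntervalIntegrable (fun t => a t - g t) volume u v :=
      fun u v => (aii u v).sub (gii u v)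
    rw [hAd, ← intervalIntegral.integral_add_adjacent_intervals (bii y I.1) (bii I.1 x),
      hz I.1 x (hend I hIS).1 hx, add_zero, intervalIntegral.integral_symm, abs_neg]
    have hl := hlt I hIS
    calc |∫ t in I.1..y, (a t - g t)| ≤ ∫ t in I.1..y, |a t - g t| :=
          intervalIntegral.abs_integral_le_integral_abs hy.1.le
      _ ≤ ∫ t in I.1..I.2, |a t - g t| := by
          apply intervalIntegral.integral_mono_interval le_rfl hy.1.le hy.2.le
            (Eventually.of_forall fun t => abs_nonneg _) (bii _ _).abs
      _ ≤ ∫ t in I.1..I.2, (|a t| + 1) := by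
          apply intervalIntegral.integral_mono_ae_restrict hl.le (bii _ _).abs
            ((aii _ _).abs.add intervalIntegrable_const)
          filter_upwards [ae_restrict_of_ae hg1] with t ht
          exact (abs_sub _ _).trans (by linarith)
      _ = (∫ t in I.1..I.2, |a t|) + (I.2 - I.1) := by
          rw [intervalIntegral.integral_add (aii _ _).abs intervalIntegrable_const]; simp
      _ ≤ _ := by linarith [hIabs I hIS]

theorem ee_cz (m : ℕ) (a : Fin m → ℝ → ℝ) (ha : ∀ j, Measurable (a j)) (p q : Fin m → ℝ)
    (hp : ∀ j, 1 ≤ p j) (hpq : ∀ j, p j ≤ q j)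
    (hfin : ∀ j, ∫⁻ y, ENNReal.ofReal (|a j y| ^ p j) ≠ ⊤) :
    (∀ j, LocallyIntegrable (a j)) ∧ ∃ (S : Set (ℝ × ℝ)) (g : Fin m → ℝ → ℝ),
      S.Countable ∧ (∀ I ∈ S, I.1 < I.2) ∧ S.PairwiseDisjoint (fun I => Ioo I.1 I.2) ∧
      volume (⋃ J ∈ S, Ioo J.1 J.2) ≤ ∑ j, ∫⁻ y, ENNReal.ofReal (|a j y| ^ p j) ∧
      (∀ j, Measurable (g j)) ∧ (∀ j, LocallyIntegrable (g j)) ∧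
      (∀ j x y, |Adiff (g j) x y| ≤ |x - y|) ∧
      (∀ j, ∫⁻ y, ENNReal.ofReal (|g j y| ^ q j) ≤
        (∫⁻ y, ENNReal.ofReal (|a j y| ^ p j)) + volume (⋃ J ∈ S, Ioo J.1 J.2)) ∧
      (∀ j x y, x ∉ (⋃ J ∈ S, Ioo J.1 J.2) → y ∉ (⋃ J ∈ S, Ioo J.1 J.2) →
        Adiff (a j) x y = Adiff (g j) x y) ∧
      (∀ j x, x ∉ (⋃ J ∈ S, Ioo J.1 J.2) → ∀ I ∈ S, ∀ y ∈ Ioo I.1 I.2,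
        |Adiff (a j) x y - Adiff (g j) x y| ≤ 2 * (I.2 - I.1)) := by
  have hmeas : ∀ j, Measurable (fun t => |a j t| ^ p j) := fun j => by
    have := ha j; fun_prop
  have hnn : ∀ j t, 0 ≤ |a j t| ^ p j := fun j t => Real.rpow_nonneg (abs_nonneg _) _
  have hIntg : ∀ j, Integrable (fun t => |a j t| ^ p j) := by
    intro j
    refine ⟨(hmeas j).aestronglyMeasurable, ?_⟩
    rw [hasFiniteIntegral_iff_ofReal (Eventually.of_forall (hnn j))]
    exact (hfin j).lt_top
  obtain ⟨S, hSc, hlt, hend, hdisj, havg, hvol, hoff⟩ :=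
    ee_rising (fun t => ∑ j, |a j t| ^ p j) (integrable_finsetSum _ fun j _ => hIntg j)
      (fun x => Finset.sum_nonneg fun j _ => hnn j x)
  have hcz : ∀ j, _ := fun j => ee_cz1 S hSc hlt hend hdisj (a j) (ha j) (p j) (q j) (hp j) (hpq j)
    (hIntg j)
    (by
      intro I hIS
      rw [← havg I hIS]
      apply intervalIntegral.integral_mono_on (hlt I hIS).le (hIntg j).intervalIntegrable
        (integrable_finsetSum _ fun j _ => hIntg j).intervalIntegrable
      intro x _
      exact Finset.single_le_sum (f := fun j => |a j x| ^ p j) (fun i _ => hnn i x) (Finset.mem_univ j))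
    (by
      filter_upwards [hoff] with x hx hxΩ
      have h1 := (Finset.single_le_sum (f := fun j => |a j x| ^ p j) (fun i _ => hnn i x)
        (Finset.mem_univ j)).trans (hx hxΩ)
      by_contra hc
      push Not at hc
      exact absurd h1 (not_le.2 (Real.one_lt_rpow hc (by linarith [hp j]))))
  choose hl g h1 h2 h3 h4 h5 h6 using hcz
  refine ⟨hl, S, g, hSc, hlt, hdisj, ?_, h1, h2, h3, h4, h5, h6⟩
  refine hvol.trans (le_of_eq ?_)
  rw [← lintegral_finsetSum _ (fun j _ => (hmeas j).ennreal_ofReal)]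
  congr 1; funext x
  rw [ENNReal.ofReal_sum_of_nonneg (fun j _ => hnn j x)]


theorem ee_prod_diff {ι : Type*} [DecidableEq ι] (s : Finset ι) (u v : ι → ℝ) (R D : ℝ) (hR : 0 ≤ R)
    (hu : ∀ j ∈ s, |u j| ≤ R) (hv : ∀ j ∈ s, |v j| ≤ R) (hD : ∀ j ∈ s, |u j - v j| ≤ D) :
    |∏ j ∈ s, u j - ∏ j ∈ s, v j| * R ≤ s.card * R ^ s.card * D := by
  induction s using Finset.induction_on with
  | empty => simp
  | insert i s hi ih =>
    have ih' := ih (fun j hj => hu j (Finset.mem_insert_of_mem hj))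
      (fun j hj => hv j (Finset.mem_insert_of_mem hj)) (fun j hj => hD j (Finset.mem_insert_of_mem hj))
    rw [Finset.prod_insert hi, Finset.prod_insert hi, Finset.card_insert_of_notMem hi]
    have hP : |∏ j ∈ s, v j| ≤ R ^ s.card := by
      rw [Finset.abs_prod]
      calc ∏ j ∈ s, |v j| ≤ ∏ j ∈ s, R :=
            Finset.prod_le_prod (fun _ _ => abs_nonneg _)
              (fun j hj => hv j (Finset.mem_insert_of_mem hj))
        _ = _ := by simp
    have e : u i * ∏ j ∈ s, u j - v i * ∏ j ∈ s, v j =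
        u i * (∏ j ∈ s, u j - ∏ j ∈ s, v j) + (u i - v i) * ∏ j ∈ s, v j := by ring
    have hui := hu i (Finset.mem_insert_self i s)
    have hDi := hD i (Finset.mem_insert_self i s)
    have hD0 : 0 ≤ D := (abs_nonneg _).trans hDi
    calc |u i * ∏ j ∈ s, u j - v i * ∏ j ∈ s, v j| * R
        ≤ (|u i| * |∏ j ∈ s, u j - ∏ j ∈ s, v j| + |u i - v i| * |∏ j ∈ s, v j|) * R := by
          rw [e, ← abs_mul, ← abs_mul]
          exact mul_le_mul_of_nonneg_right (abs_add_le _ _) hR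
      _ = |u i| * (|∏ j ∈ s, u j - ∏ j ∈ s, v j| * R) + |u i - v i| * |∏ j ∈ s, v j| * R := by ring
      _ ≤ R * (s.card * R ^ s.card * D) + D * R ^ s.card * R := by
          gcongr
      _ = _ := by push_cast; ring

theorem ee_lim_abs (T S B : ℝ → ℝ) (b : ℝ) (l : Filter ℝ) [l.NeBot] (hS : ∀ᶠ ε in l, S ε = 2 * (T ε - B ε))
    (hB : Tendsto B l (nhds b)) (hb : |b| ≤ 1 / 2) (h : 1 < |limUnder l T|) : 1 < |limUnder l S| := by
  by_cases hc : ∃ L, Tendsto T l (nhds L)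
  · obtain ⟨L, hL⟩ := hc
    have h2 : Tendsto S l (nhds (2 * (L - b))) :=
      ((hL.sub hB).const_mul 2).congr' (hS.mono fun _ h => h.symm)
    rw [hL.limUnder_eq] at h
    rw [h2.limUnder_eq, abs_mul, abs_two]
    have := abs_sub_abs_le_abs_sub L b
    linarith
  · have hc2 : ¬ ∃ L, Tendsto S l (nhds L) := by
      rintro ⟨L, hL⟩
      apply hc
      refine ⟨L / 2 + b, ((hL.div_const 2).add hB).congr' (hS.mono fun ε h => ?_)⟩
      rw [h]; ring
    push Not at hc hc2
    have e : limUnder l T = limUnder l S := by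
      unfold limUnder lim
      congr 1
      funext x
      exact propext ⟨fun h => absurd h (hc x), fun h => absurd h (hc2 x)⟩
    rwa [← e]

theorem ee_trunc_meas (x ε : ℝ) : MeasurableSet {y : ℝ | ε < |x - y|} :=
  measurableSet_lt measurable_const (by fun_prop)

theorem ee_trunc_tendsto (x : ℝ) (b : ℝ → ℝ) (hb : Integrable b) :
    Tendsto (fun ε => ∫ y in {y : ℝ | ε < |x - y|}, b y) (nhdsWithin 0 (Ioi 0)) (nhds (∫ y, b y)) := by
  simp_rw [← integral_indicator (ee_trunc_meas x _)]
  refine tendsto_integral_filter_of_dominated_convergence (fun y => ‖b y‖) ?_ ?_ hb.norm ?_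
  · exact Eventually.of_forall fun ε => hb.aestronglyMeasurable.indicator (ee_trunc_meas x ε)
  · exact Eventually.of_forall fun ε => Eventually.of_forall fun y => norm_indicator_le_norm_self _ _
  · have hne : ∀ᵐ y : ℝ, y ≠ x := by simp [ae_iff]
    filter_upwards [hne] with y hy
    apply tendsto_const_nhds.congr'
    have hpos : 0 < |x - y| := abs_pos.2 (sub_ne_zero.2 hy.symm)
    have : ∀ᶠ ε in nhdsWithin (0:ℝ) (Ioi 0), ε < |x - y| :=
      (eventually_lt_nhds hpos).filter_mono nhdsWithin_le_nhds
    filter_upwards [this] with ε hε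
    rw [indicator_of_mem]
    exact hε

/-- If a nonzero limit occurs, all truncated integrands are integrable. -/
theorem ee_all_int (x : ℝ) (k : ℝ → ℝ)
    (h : limUnder (nhdsWithin 0 (Ioi 0)) (fun ε : ℝ => ∫ y in {y : ℝ | ε < |x - y|}, k y) ≠ 0) :
    ∀ ε : ℝ, 0 < ε → IntegrableOn k {y : ℝ | ε < |x - y|} := by
  intro ε hε
  by_contra hc
  apply h
  apply Tendsto.limUnder_eq
  apply tendsto_const_nhds.congr'
  have : ∀ᶠ δ in nhdsWithin (0:ℝ) (Ioi 0), δ < ε :=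
    (eventually_lt_nhds hε).filter_mono nhdsWithin_le_nhds
  filter_upwards [this] with δ hδ
  rw [integral_undef]
  intro hi
  exact hc (IntegrableOn.mono_set hi (fun y (hy : ε < |x - y|) => (hδ.trans hy : δ < |x - y|)))

theorem ee_pt (x : ℝ) (ka kg f : ℝ → ℝ) (hb : Integrable (fun y => (ka y - kg y) * f y))
    (hb2 : |∫ y, (ka y - kg y) * f y| ≤ 1 / 2)
    (h : 1 < |limUnder (nhdsWithin 0 (Ioi 0)) (fun ε : ℝ => ∫ y in {y : ℝ | ε < |x - y|}, ka y * f y)|) :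
    1 < |limUnder (nhdsWithin 0 (Ioi 0)) (fun ε : ℝ => ∫ y in {y : ℝ | ε < |x - y|}, kg y * (2 * f y))| := by
  have hall := ee_all_int x (fun y => ka y * f y) (by intro h0; rw [h0] at h; simp at h; linarith)
  refine ee_lim_abs _ _ (fun ε => ∫ y in {y : ℝ | ε < |x - y|}, (ka y - kg y) * f y) _ _ ?_
    (ee_trunc_tendsto x _ hb) hb2 h
  filter_upwards [self_mem_nhdsWithin] with ε hε
  rw [← integral_sub (hall ε hε) hb.integrableOn, ← integral_const_mul]
  congr 1; funext y; ring


/-- The kernel of the commutator. -/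
noncomputable def eeK (m : ℕ) (A A' : ℝ → ℝ) (a : Fin m → ℝ → ℝ) (x y : ℝ) : ℝ :=
  (P2 A A' x y * ∏ j, Adiff (a j) x y) / (x - y) ^ (m + 2)

theorem ee_CcommA_eq (m : ℕ) (A A' : ℝ → ℝ) (a : Fin m → ℝ → ℝ) (f : ℝ → ℝ) (x : ℝ) :
    CcommA m A A' a f x = limUnder (nhdsWithin 0 (Ioi 0)) (fun ε : ℝ =>
      ∫ y in {y : ℝ | ε < |x - y|}, eeK m A A' a x y * f y) := rfl

theorem ee_K_diff (m : ℕ) (A A' : ℝ → ℝ) (a g : Fin m → ℝ → ℝ) (x y s : ℝ) (hs : 0 < s)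
    (hxy : s ≤ |x - y|) (hg : ∀ j, |Adiff (g j) x y| ≤ |x - y|)
    (hag : ∀ j, |Adiff (a j) x y - Adiff (g j) x y| ≤ 2 * s) :
    |eeK m A A' a x y - eeK m A A' g x y| ≤ (2 * m * 3 ^ m) * s * (|P2 A A' x y| / |x - y| ^ 3) := by
  have hr : 0 < |x - y| := hs.trans_le hxy
  have h1 := ee_prod_diff Finset.univ (fun j => Adiff (a j) x y) (fun j => Adiff (g j) x y)
    (3 * |x - y|) (2 * s) (by positivity)
    (fun j _ => by
      have := abs_sub_abs_le_abs_sub (Adiff (a j) x y) (Adiff (g j) x y)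
      linarith [hg j, hag j])
    (fun j _ => by linarith [hg j]) (fun j _ => hag j)
  rw [Finset.card_univ, Fintype.card_fin] at h1
  unfold eeK
  rw [← sub_div, ← mul_sub, abs_div, abs_mul, abs_pow]
  set r := |x - y| with hrdef
  set W := |∏ j, Adiff (a j) x y - ∏ j, Adiff (g j) x y| with hW
  have h2 : W * r ≤ 2 * m * 3 ^ m * s * r ^ m := by
    have : W * r ≤ W * (3 * r) := by
      have : 0 ≤ W := abs_nonneg _
      nlinarith
    refine this.trans (h1.trans (le_of_eq ?_))
    rw [mul_pow]; ring
  rw [div_le_iff₀ (by positivity)]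
  have e : 2 * m * 3 ^ m * s * (|P2 A A' x y| / r ^ 3) * r ^ (m + 2) =
      |P2 A A' x y| * (2 * m * 3 ^ m * s * r ^ m / r) := by
    field_simp; ring
  rw [e]
  apply mul_le_mul_of_nonneg_left _ (abs_nonneg _)
  rw [le_div_iff₀ hr]; exact h2

theorem eeBMO.P2_meas {A A' : ℝ → ℝ} {M : ℝ} (h : eeBMO A A' M) :
    Measurable (fun z : ℝ × ℝ => P2 A A' z.1 z.2) := by
  have h1 := h.cont.measurable
  have h2 := h.meas
  unfold P2
  fun_prop

theorem ee_Adiff_meas (a : ℝ → ℝ) (ha : LocallyIntegrable a) (x : ℝ) :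
    Measurable (fun y => Adiff a x y) := by
  have hii : ∀ u v, IntervalIntegrable a volume u v := fun u v =>
    (ha.integrableOn_isCompact isCompact_uIcc).intervalIntegrable
  have : (fun y => Adiff a x y) = fun y => - ∫ t in x..y, a t := by
    funext y; rw [Adiff, intervalIntegral.integral_symm]
  rw [this]
  exact (intervalIntegral.continuous_primitive hii x).neg.measurable

theorem eeBMO.K_meas {A A' : ℝ → ℝ} {M : ℝ} (h : eeBMO A A' M) (m : ℕ) (a : Fin m → ℝ → ℝ)
    (ha : ∀ j, LocallyIntegrable (a j)) (x : ℝ) : Measurable (fun y => eeK m A A' a x y) := by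
  have h1 : Measurable (fun y => P2 A A' x y) := h.P2_meas.comp (measurable_const.prodMk measurable_id)
  have h2 : Measurable (fun y => ∏ j, Adiff (a j) x y) :=
    Finset.measurable_fun_prod _ fun j _ => ee_Adiff_meas _ (ha j) x
  unfold eeK
  fun_prop

theorem eeBMO.bad_est {A A' : ℝ → ℝ} {M : ℝ} (h : eeBMO A A' M) (q b Cm : ℝ) (hq : 1 ≤ q) (hb : 0 ≤ b)
    (hqb : q = 1 → 1 ≤ b) (hCm : 0 ≤ Cm) :
    ∃ K : ℝ, 0 < K ∧ ∀ (S : Set (ℝ × ℝ)) (f : ℝ → ℝ), S.Countable → (∀ I ∈ S, I.1 < I.2) →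
      S.PairwiseDisjoint (fun I => Ioo I.1 I.2) → Measurable f →
      volume {x : ℝ | x ∉ (⋃ I ∈ S, Ioo (2 * I.1 - I.2) (2 * I.2 - I.1)) ∧
        1 / 2 < ∑' I : S, ∫⁻ y in Ioo I.1.1 I.1.2,
          ENNReal.ofReal (Cm * (I.1.2 - I.1.1) * (|P2 A A' x y| / |x - y| ^ 3) * |f y|)} ≤
      ENNReal.ofReal (2 * Cm * K) * (volume (⋃ I ∈ S, Ioo I.1 I.2) +
        ∫⁻ y, ENNReal.ofReal (|f y| ^ q * Real.log (Real.exp 1 + |f y|) ^ b)) := by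
  obtain ⟨K0, hK0, hk⟩ := h.ker_int
  obtain ⟨K, hK, hf⟩ := h.f_int q b K0 hq hb hqb hK0
  refine ⟨K, hK, fun S f hSc hlt hdisj hfm => ?_⟩
  have : Countable S := hSc.to_subtype
  set U := ⋃ I ∈ S, Ioo (2 * I.1 - I.2) (2 * I.2 - I.1) with hU
  have hUm : MeasurableSet U := (isOpen_biUnion fun _ _ => isOpen_Ioo).measurableSet
  set Φ : ℝ → ℝ≥0∞ := fun y => ENNReal.ofReal (|f y| ^ q * Real.log (Real.exp 1 + |f y|) ^ b) with hΦ
  have hPm := h.P2_meas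
  set F : S → ℝ → ℝ → ℝ≥0∞ := fun I x y =>
    ENNReal.ofReal (Cm * (I.1.2 - I.1.1) * (|P2 A A' x y| / |x - y| ^ 3) * |f y|) with hF
  have hFm : ∀ I, Measurable (Function.uncurry (F I)) := by
    intro I
    have : Measurable (fun z : ℝ × ℝ => |P2 A A' z.1 z.2|) := by
      exact measurable_norm.comp hPm
    apply Measurable.ennreal_ofReal
    fun_prop
  set G : S → ℝ → ℝ≥0∞ := fun I x => ∫⁻ y in Ioo I.1.1 I.1.2, F I x y with hG
  have hGm : ∀ I, Measurable (G I) := fun I => (hFm I).lintegral_prod_right'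
  have hone : ∀ I : S, ∫⁻ x in Uᶜ, G I x ≤ ENNReal.ofReal Cm * (ENNReal.ofReal K *
      (volume (Ioo I.1.1 I.1.2) + ∫⁻ y in Ioo I.1.1 I.1.2, Φ y)) := by
    intro I
    have hl := hlt _ I.2
    calc ∫⁻ x in Uᶜ, G I x ≤ ∫⁻ x in (Ioo (2 * I.1.1 - I.1.2) (2 * I.1.2 - I.1.1))ᶜ, G I x := by
          apply lintegral_mono_set
          apply compl_subset_compl.2
          exact subset_biUnion_of_mem (u := fun I : ℝ × ℝ => Ioo (2 * I.1 - I.2) (2 * I.2 - I.1)) I.2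
      _ = ∫⁻ y in Ioo I.1.1 I.1.2, ∫⁻ x in (Ioo (2 * I.1.1 - I.1.2) (2 * I.1.2 - I.1.1))ᶜ, F I x y :=
          lintegral_lintegral_swap (hFm I).aemeasurable
      _ ≤ ∫⁻ y in Ioo I.1.1 I.1.2, ENNReal.ofReal Cm *
            ENNReal.ofReal (|f y| * (K0 + 2 * |A' y - eeSl A I.1.1 I.1.2|)) := by
          apply setLIntegral_mono' measurableSet_Ioo
          intro y hy
          have hs : 0 < I.1.2 - I.1.1 := by linarith
          have e : ∀ x, F I x y = ENNReal.ofReal (Cm * (I.1.2 - I.1.1) * |f y|) *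
              ENNReal.ofReal (|P2 A A' x y| / |x - y| ^ 3) := by
            intro x
            rw [← ENNReal.ofReal_mul (by positivity)]
            simp only [hF]; congr 1; ring
          simp_rw [e]
          rw [lintegral_const_mul' _ _ ENNReal.ofReal_ne_top]
          refine (mul_le_mul_right (hk _ _ y hy) _).trans (le_of_eq ?_)
          rw [← ENNReal.ofReal_mul (by positivity), ← ENNReal.ofReal_mul hCm]
          congr 1
          field_simp
      _ = ENNReal.ofReal Cm * ∫⁻ y in Ioo I.1.1 I.1.2,
            ENNReal.ofReal (|f y| * (K0 + 2 * |A' y - eeSl A I.1.1 I.1.2|)) :=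
          lintegral_const_mul' _ _ ENNReal.ofReal_ne_top
      _ ≤ _ := by
          rw [Real.volume_Ioo]
          exact mul_le_mul_right (hf _ _ f hl) _
  have hsum : ∫⁻ x in Uᶜ, ∑' I, G I x ≤ ENNReal.ofReal (Cm * K) *
      (volume (⋃ I ∈ S, Ioo I.1 I.2) + ∫⁻ y, Φ y) := by
    rw [lintegral_tsum fun I => (hGm I).aemeasurable]
    calc ∑' I, ∫⁻ x in Uᶜ, G I x ≤ ∑' I : S, ENNReal.ofReal Cm * (ENNReal.ofReal K *
          (volume (Ioo I.1.1 I.1.2) + ∫⁻ y in Ioo I.1.1 I.1.2, Φ y)) := ENNReal.tsum_le_tsum hone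
      _ = ENNReal.ofReal (Cm * K) * ((∑' I : S, volume (Ioo I.1.1 I.1.2)) +
            ∑' I : S, ∫⁻ y in Ioo I.1.1 I.1.2, Φ y) := by
          rw [ENNReal.tsum_mul_left, ENNReal.tsum_mul_left, ENNReal.tsum_add, ENNReal.ofReal_mul hCm,
            mul_assoc]
      _ ≤ _ := by
          rw [measure_biUnion hSc hdisj (fun _ _ => measurableSet_Ioo)]
          gcongr
          rw [← lintegral_biUnion hSc (fun _ _ => measurableSet_Ioo) hdisj]
          exact setLIntegral_le_lintegral _ _
  have hGtm : Measurable (fun x => ∑' I, G I x) := Measurable.tsum hGm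
  have hMk := mul_meas_ge_le_lintegral₀ (μ := volume.restrict Uᶜ) hGtm.aemeasurable (1 / 2 : ℝ≥0∞)
  have hsub : volume {x : ℝ | x ∉ U ∧ 1 / 2 < ∑' I : S, G I x} ≤
      volume.restrict Uᶜ {x | 1 / 2 ≤ ∑' I, G I x} := by
    rw [Measure.restrict_apply' hUm.compl]
    exact measure_mono fun x hx => ⟨hx.2.le, hx.1⟩
  refine hsub.trans ?_
  have h2 : volume.restrict Uᶜ {x | 1 / 2 ≤ ∑' I, G I x} =
      2 * (1 / 2 * volume.restrict Uᶜ {x | 1 / 2 ≤ ∑' I, G I x}) := by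
    rw [← mul_assoc, one_div, ENNReal.mul_inv_cancel (by simp) (by simp), one_mul]
  rw [h2, mul_assoc 2 Cm K, ENNReal.ofReal_mul (by norm_num), mul_assoc]
  simp only [ENNReal.ofReal_ofNat]
  exact mul_le_mul_right (hMk.trans hsum) _


theorem ee_log_two (t : ℝ) (ht : 0 ≤ t) :
    Real.log (Real.exp 1 + 2 * t) ≤ 2 * Real.log (Real.exp 1 + t) := by
  have he : 2 < Real.exp 1 := by linarith [Real.exp_one_gt_d9]
  rw [← Real.log_rpow (by positivity) , Real.rpow_two]
  apply Real.log_le_log (by positivity)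
  nlinarith

theorem ee_log_one (t : ℝ) (ht : 0 ≤ t) : 1 ≤ Real.log (Real.exp 1 + t) := by
  rw [Real.le_log_iff_exp_le (by positivity)]
  linarith

theorem ee_Phi_two (q β b t : ℝ) (hβ : 0 ≤ β) (hβb : β ≤ b) :
    |2 * t| ^ q * Real.log (Real.exp 1 + |2 * t|) ^ β ≤
      (2 ^ q * 2 ^ β) * (|t| ^ q * Real.log (Real.exp 1 + |t|) ^ b) := by
  have h1 := ee_log_one |t| (abs_nonneg t)
  have h2 := ee_log_two |t| (abs_nonneg t)
  have h3 := ee_log_one (2 * |t|) (by positivity)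
  rw [abs_mul, abs_two, Real.mul_rpow (by norm_num) (abs_nonneg t)]
  have h4 : Real.log (Real.exp 1 + 2 * |t|) ^ β ≤ 2 ^ β * Real.log (Real.exp 1 + |t|) ^ b := by
    calc Real.log (Real.exp 1 + 2 * |t|) ^ β ≤ (2 * Real.log (Real.exp 1 + |t|)) ^ β :=
          Real.rpow_le_rpow (by linarith) h2 hβ
      _ = 2 ^ β * Real.log (Real.exp 1 + |t|) ^ β := Real.mul_rpow (by norm_num) (by linarith)
      _ ≤ _ := mul_le_mul_of_nonneg_left (Real.rpow_le_rpow_of_exponent_le h1 hβb) (by positivity)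
  calc 2 ^ q * |t| ^ q * Real.log (Real.exp 1 + 2 * |t|) ^ β
      ≤ 2 ^ q * |t| ^ q * (2 ^ β * Real.log (Real.exp 1 + |t|) ^ b) :=
        mul_le_mul_of_nonneg_left h4 (by positivity)
    _ = _ := by ring

theorem ee_core (m : ℕ) (A A' : ℝ → ℝ) (M : ℝ) (h : eeBMO A A' M)
    (q : Fin (m + 1) → ℝ) (hq : ∀ i, 1 ≤ q i) (β : ℝ) (hβ : 0 ≤ β) (C : ℝ)
    (hyp : ∀ (a : Fin m → ℝ → ℝ) (f : ℝ → ℝ),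
      volume {x : ℝ | 1 < |CcommA m A A' a f x|} ≤
        ENNReal.ofReal C *
          ((∑ j : Fin m, ∫⁻ y, ENNReal.ofReal (|a j y| ^ q j.castSucc)) +
            ∫⁻ y, ENNReal.ofReal
              (|f y| ^ q (Fin.last m) * Real.log (Real.exp 1 + |f y|) ^ β)))
    (p : Fin m → ℝ) (hp : ∀ j, 1 ≤ p j ∧ p j < q j.castSucc)
    (b : ℝ) (hβb : β ≤ b) (hqb : q (Fin.last m) = 1 → 1 ≤ b) :
    ∃ C' : ℝ, 0 < C' ∧
      ∀ (a : Fin m → ℝ → ℝ) (f : ℝ → ℝ), (∀ j, Measurable (a j)) → Measurable f →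
        (∀ j, ∫⁻ y, ENNReal.ofReal (|a j y| ^ p j) ≠ ⊤) →
        volume {x : ℝ | 1 < |CcommA m A A' a f x|} ≤
          ENNReal.ofReal C' *
            ((∑ j : Fin m, ∫⁻ y, ENNReal.ofReal (|a j y| ^ p j)) +
              ∫⁻ y, ENNReal.ofReal
                (|f y| ^ q (Fin.last m) * Real.log (Real.exp 1 + |f y|) ^ b)) := by
  set Cm : ℝ := 2 * m * 3 ^ m with hCmdef
  have hCm : 0 ≤ Cm := by positivity
  obtain ⟨K, hK, hbad⟩ := h.bad_est (q (Fin.last m)) b Cm (hq _) (hβ.trans hβb) hqb hCm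
  set cf : ℝ := 2 ^ q (Fin.last m) * 2 ^ β with hcf
  have hcf0 : 0 ≤ cf := by positivity
  refine ⟨3 + |C| * (1 + m + cf) + 2 * Cm * K, by positivity, fun a f ha hf hfin => ?_⟩
  obtain ⟨hla, S, g, hSc, hlt, hdisj, hvol, hgm, hlg, hg1, hgq, hoff, hon⟩ :=
    ee_cz m a ha p (fun j => q j.castSucc) (fun j => (hp j).1) (fun j => (hp j).2.le) hfin
  have : Countable S := hSc.to_subtype
  set N := ∑ j : Fin m, ∫⁻ y, ENNReal.ofReal (|a j y| ^ p j) with hN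
  set F := ∫⁻ y, ENNReal.ofReal
    (|f y| ^ q (Fin.last m) * Real.log (Real.exp 1 + |f y|) ^ b) with hF
  set Ω := ⋃ J ∈ S, Ioo J.1 J.2 with hΩ
  set U := ⋃ I ∈ S, Ioo (2 * I.1 - I.2) (2 * I.2 - I.1) with hU
  have hΩU : Ω ⊆ U := by
    apply iUnion₂_mono
    intro I hI x hx
    have := hlt I hI
    exact ⟨by linarith [hx.1], by linarith [hx.2]⟩
  have hΩm : MeasurableSet Ω := (isOpen_biUnion fun _ _ => isOpen_Ioo).measurableSet
  have hUvol : volume U ≤ 3 * N := by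
    calc volume U ≤ ∑' I : S, volume (Ioo (2 * I.1.1 - I.1.2) (2 * I.1.2 - I.1.1)) :=
          measure_biUnion_le _ hSc _
      _ = ∑' I : S, 3 * volume (Ioo I.1.1 I.1.2) := by
          congr 1; funext I
          rw [Real.volume_Ioo, Real.volume_Ioo, show (3 : ℝ≥0∞) = ENNReal.ofReal 3 by simp,
            ← ENNReal.ofReal_mul (by norm_num)]
          congr 1; ring
      _ = 3 * volume Ω := by
          rw [ENNReal.tsum_mul_left, ← measure_biUnion hSc hdisj (fun _ _ => measurableSet_Ioo)]
      _ ≤ _ := mul_le_mul_right hvol _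
  set B := {x : ℝ | x ∉ U ∧
        1 / 2 < ∑' I : S, ∫⁻ y in Ioo I.1.1 I.1.2,
          ENNReal.ofReal (Cm * (I.1.2 - I.1.1) * (|P2 A A' x y| / |x - y| ^ 3) * |f y|)} with hB
  have hBvol : volume B ≤ ENNReal.ofReal (2 * Cm * K) * (N + F) :=
    (hbad S f hSc hlt hdisj hf).trans (by gcongr)
  have hEg : volume {x : ℝ | 1 < |CcommA m A A' g (fun y => 2 * f y) x|} ≤
      ENNReal.ofReal |C| * (ENNReal.ofReal (1 + m + cf) * (N + F)) := by
    refine (hyp g (fun y => 2 * f y)).trans ?_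
    refine mul_le_mul' (ENNReal.ofReal_le_ofReal (le_abs_self C)) ?_
    have h1 : ∑ j : Fin m, ∫⁻ y, ENNReal.ofReal (|g j y| ^ q j.castSucc) ≤
        ENNReal.ofReal (1 + m) * N := by
      calc ∑ j : Fin m, ∫⁻ y, ENNReal.ofReal (|g j y| ^ q j.castSucc)
          ≤ ∑ j : Fin m, ((∫⁻ y, ENNReal.ofReal (|a j y| ^ p j)) + N) :=
            Finset.sum_le_sum fun j _ => (hgq j).trans (by gcongr)
        _ = N + m * N := by
            rw [Finset.sum_add_distrib, Finset.sum_const, Finset.card_univ, Fintype.card_fin,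
              nsmul_eq_mul]
        _ = _ := by
            rw [ENNReal.ofReal_add (by norm_num) (by positivity), add_mul]; simp
    have h2 : ∫⁻ y, ENNReal.ofReal
              (|2 * f y| ^ q (Fin.last m) * Real.log (Real.exp 1 + |2 * f y|) ^ β) ≤
        ENNReal.ofReal cf * F := by
      rw [hF, ← lintegral_const_mul' _ _ ENNReal.ofReal_ne_top]
      apply lintegral_mono
      intro y
      dsimp only
      rw [← ENNReal.ofReal_mul hcf0]
      exact ENNReal.ofReal_le_ofReal (ee_Phi_two _ _ _ _ hβ hβb)
    refine (add_le_add h1 h2).trans ?_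
    have hm0 : (0:ℝ) ≤ m := by positivity
    rw [mul_add]
    refine add_le_add (mul_le_mul_left (ENNReal.ofReal_le_ofReal (by linarith)) _)
      (mul_le_mul_left (ENNReal.ofReal_le_ofReal (by linarith)) _)
  have hincl : {x : ℝ | 1 < |CcommA m A A' a f x|} ⊆
      U ∪ {x : ℝ | 1 < |CcommA m A A' g (fun y => 2 * f y) x|} ∪ B := by
    intro x hx
    by_cases hxU : x ∈ U
    · exact Or.inl (Or.inl hxU)
    by_cases hxB : x ∈ B
    · exact Or.inr hxB
    left; right
    have hxΩ : x ∉ Ω := fun h => hxU (hΩU h)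
    have hle : ∑' I : S, ∫⁻ y in Ioo I.1.1 I.1.2,
          ENNReal.ofReal (Cm * (I.1.2 - I.1.1) * (|P2 A A' x y| / |x - y| ^ 3) * |f y|) ≤ 1 / 2 := by
      by_contra hc
      exact hxB ⟨hxU, not_le.1 hc⟩
    have hmeas : Measurable (fun y => (eeK m A A' a x y - eeK m A A' g x y) * f y) :=
      ((h.K_meas m a hla x).sub (h.K_meas m g hlg x)).mul hf
    have hnorm : ∫⁻ y, ENNReal.ofReal |(eeK m A A' a x y - eeK m A A' g x y) * f y| ≤ 1 / 2 := by
      refine le_trans ?_ hle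
      rw [← lintegral_add_compl _ hΩm]
      have hz : ∫⁻ y in Ωᶜ, ENNReal.ofReal |(eeK m A A' a x y - eeK m A A' g x y) * f y| = 0 := by
        rw [setLIntegral_congr_fun (g := fun _ => 0) hΩm.compl]
        · simp
        · intro y hy
          have : eeK m A A' a x y = eeK m A A' g x y := by
            unfold eeK
            congr 2
            exact Finset.prod_congr rfl fun j _ => hoff j x y hxΩ hy
          simp [this]
      rw [hz, add_zero, lintegral_biUnion hSc (fun _ _ => measurableSet_Ioo) hdisj]
      apply ENNReal.tsum_le_tsum
      intro I
      apply setLIntegral_mono' measurableSet_Ioo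
      intro y hy
      apply ENNReal.ofReal_le_ofReal
      rw [abs_mul]
      apply mul_le_mul_of_nonneg_right _ (abs_nonneg _)
      have hl := hlt _ I.2
      have hxI : x ∉ Ioo (2 * I.1.1 - I.1.2) (2 * I.1.2 - I.1.1) := fun hh =>
        hxU (mem_biUnion I.2 hh)
      have hxy : I.1.2 - I.1.1 ≤ |x - y| := by
        rw [mem_Ioo, not_and_or, not_lt, not_lt] at hxI
        rw [le_abs]
        rcases hxI with hh | hh
        · right; linarith [hy.1]
        · left; linarith [hy.2]
      exact ee_K_diff m A A' a g x y _ (by linarith) hxy (fun j => hg1 j x y)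
        (fun j => hon j x hxΩ I.1 I.2 y hy)
    have hIntg : Integrable (fun y => (eeK m A A' a x y - eeK m A A' g x y) * f y) := by
      refine ⟨hmeas.aestronglyMeasurable, ?_⟩
      rw [hasFiniteIntegral_iff_norm]
      exact hnorm.trans_lt (by simp)
    have habs : |∫ y, (eeK m A A' a x y - eeK m A A' g x y) * f y| ≤ 1 / 2 := by
      have h1 := norm_integral_le_lintegral_norm (μ := volume)
        (fun y => (eeK m A A' a x y - eeK m A A' g x y) * f y)
      refine h1.trans ?_
      refine ENNReal.toReal_le_of_le_ofReal (by norm_num) (hnorm.trans (le_of_eq ?_))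
      rw [ENNReal.ofReal_div_of_pos (by norm_num)]; simp
    have := ee_pt x (eeK m A A' a x) (eeK m A A' g x) f hIntg habs hx
    exact this
  calc volume {x : ℝ | 1 < |CcommA m A A' a f x|} ≤ volume U +
        volume {x : ℝ | 1 < |CcommA m A A' g (fun y => 2 * f y) x|} + volume B :=
      (measure_mono hincl).trans ((measure_union_le _ _).trans (by gcongr; exact measure_union_le _ _))
    _ ≤ 3 * (N + F) + ENNReal.ofReal |C| * (ENNReal.ofReal (1 + m + cf) * (N + F)) +
        ENNReal.ofReal (2 * Cm * K) * (N + F) := by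
      gcongr
      exact hUvol.trans (by gcongr; exact le_self_add)
    _ = _ := by
      rw [show ENNReal.ofReal (3 + |C| * (1 + m + cf) + 2 * Cm * K) =
          ENNReal.ofReal 3 + ENNReal.ofReal |C| * ENNReal.ofReal (1 + m + cf) +
            ENNReal.ofReal (2 * Cm * K) by
        rw [ENNReal.ofReal_add (by positivity) (by positivity),
          ENNReal.ofReal_add (by norm_num) (by positivity), ENNReal.ofReal_mul (abs_nonneg C)]]
      simp only [ENNReal.ofReal_ofNat]
      ring


/-- The desired estimate for a given tuple of functions. -/
def eeBd (m : ℕ) (A A' : ℝ → ℝ) (p : Fin m → ℝ) (q b C' : ℝ) (a : Fin m → ℝ → ℝ) (f : ℝ → ℝ) : Prop :=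
  volume {x : ℝ | 1 < |CcommA m A A' a f x|} ≤
    ENNReal.ofReal C' * ((∑ j : Fin m, ∫⁻ y, ENNReal.ofReal (|a j y| ^ p j)) +
      ∫⁻ y, ENNReal.ofReal (|f y| ^ q * Real.log (Real.exp 1 + |f y|) ^ b))

theorem ee_max_set (f : ℝ → ℝ) : ∃ S : Set ℝ, MeasurableSet S ∧
    AEMeasurable f (volume.restrict S) ∧
    ∀ T : Set ℝ, MeasurableSet T → AEMeasurable f (volume.restrict T) → volume (T \ S) = 0 := by
  set μ : Measure ℝ := (volume : Measure ℝ).toFinite with hμ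
  set 𝒯 : Set (Set ℝ) := {T | MeasurableSet T ∧ AEMeasurable f (volume.restrict T)} with h𝒯
  obtain ⟨u, -, hu, huS⟩ := exists_seq_tendsto_sSup (S := μ '' 𝒯)
    ⟨μ ∅, ∅, ⟨MeasurableSet.empty, by simp⟩, rfl⟩ (OrderTop.bddAbove _)
  choose T hT hTu using huS
  refine ⟨⋃ n, T n, MeasurableSet.iUnion fun n => (hT n).1,
    aemeasurable_iUnion_iff.2 fun n => (hT n).2, ?_⟩
  intro R hR hRf
  set S := ⋃ n, T n with hS
  have hSm : MeasurableSet S := MeasurableSet.iUnion fun n => (hT n).1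
  have hSf : AEMeasurable f (volume.restrict S) := aemeasurable_iUnion_iff.2 fun n => (hT n).2
  have h1 : sSup (μ '' 𝒯) ≤ μ S := by
    refine le_of_tendsto' hu fun n => ?_
    rw [← hTu n]
    exact measure_mono (subset_iUnion T n)
  have h2 : μ (S ∪ R) ≤ μ S :=
    (le_sSup (mem_image_of_mem μ (show S ∪ R ∈ 𝒯 from
      ⟨hSm.union hR, aemeasurable_union_iff.2 ⟨hSf, hRf⟩⟩))).trans h1
  have h3 : μ (R \ S) = 0 := by
    have : μ (S ∪ R) = μ S + μ (R \ S) := by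
      rw [← union_sdiff_self, measure_union disjoint_sdiff_right (hR.diff hSm)]
    rw [this] at h2
    by_contra h0
    exact absurd h2 (not_le.2 (ENNReal.lt_add_right (measure_ne_top _ _) h0))
  exact absolutelyContinuous_toFinite _ h3

theorem ee_congr (m : ℕ) (A A' : ℝ → ℝ) (a a2 : Fin m → ℝ → ℝ) (f f2 : ℝ → ℝ)
    (ha : ∀ j, a j =ᵐ[volume] a2 j) (hf : f =ᵐ[volume] f2) : CcommA m A A' a f = CcommA m A A' a2 f2 := by
  funext x
  rw [ee_CcommA_eq, ee_CcommA_eq]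
  congr 1; funext ε
  apply setIntegral_congr_ae (ee_trunc_meas x ε)
  filter_upwards [hf] with y hy _
  have : eeK m A A' a x y = eeK m A A' a2 x y := by
    unfold eeK
    congr 2
    refine Finset.prod_congr rfl fun j _ => ?_
    apply intervalIntegral.integral_congr_ae
    filter_upwards [ha j] with t ht _ using ht
  rw [hy, this]

theorem ee_bd_congr (m : ℕ) (A A' : ℝ → ℝ) (p : Fin m → ℝ) (q b C' : ℝ) (a a2 : Fin m → ℝ → ℝ) (f f2 : ℝ → ℝ)
    (ha : ∀ j, a j =ᵐ[volume] a2 j) (hf : f =ᵐ[volume] f2) (h : eeBd m A A' p q b C' a2 f2) :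
    eeBd m A A' p q b C' a f := by
  unfold eeBd at *
  rw [ee_congr m A A' a a2 f f2 ha hf]
  have e1 : ∑ j : Fin m, ∫⁻ y, ENNReal.ofReal (|a j y| ^ p j) =
      ∑ j : Fin m, ∫⁻ y, ENNReal.ofReal (|a2 j y| ^ p j) := by
    refine Finset.sum_congr rfl fun j _ => lintegral_congr_ae ?_
    filter_upwards [ha j] with t ht
    rw [ht]
  have e2 : ∫⁻ y, ENNReal.ofReal (|f y| ^ q * Real.log (Real.exp 1 + |f y|) ^ b) =
      ∫⁻ y, ENNReal.ofReal (|f2 y| ^ q * Real.log (Real.exp 1 + |f2 y|) ^ b) := by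
    refine lintegral_congr_ae ?_
    filter_upwards [hf] with t ht
    rw [ht]
  rw [e1, e2]
  exact h

theorem ee_Phi_zero (q b : ℝ) (hq : 1 ≤ q) :
    ENNReal.ofReal (|(0:ℝ)| ^ q * Real.log (Real.exp 1 + |(0:ℝ)|) ^ b) = 0 := by
  rw [abs_zero, Real.zero_rpow (by linarith), zero_mul, ENNReal.ofReal_zero]

theorem ee_ind_Phi (q b : ℝ) (hq : 1 ≤ q) (f : ℝ → ℝ) (S : Set ℝ) (hS : MeasurableSet S) :
    ∫⁻ y, ENNReal.ofReal (|S.indicator f y| ^ q * Real.log (Real.exp 1 + |S.indicator f y|) ^ b) =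
      ∫⁻ y in S, ENNReal.ofReal (|f y| ^ q * Real.log (Real.exp 1 + |f y|) ^ b) := by
  rw [← lintegral_indicator hS]
  congr 1; funext y
  by_cases hy : y ∈ S
  · simp only [indicator_of_mem hy]
  · simp only [indicator_of_notMem hy]
    exact ee_Phi_zero q b hq

theorem ee_ind_p (p : ℝ) (hp : 1 ≤ p) (a : ℝ → ℝ) (S : Set ℝ) (hS : MeasurableSet S) :
    ∫⁻ y, ENNReal.ofReal (|S.indicator a y| ^ p) = ∫⁻ y in S, ENNReal.ofReal (|a y| ^ p) := by
  rw [← lintegral_indicator hS]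
  congr 1; funext y
  by_cases hy : y ∈ S
  · simp only [indicator_of_mem hy]
  · simp only [indicator_of_notMem hy]
    rw [abs_zero, Real.zero_rpow (by linarith), ENNReal.ofReal_zero]

section red
variable {m : ℕ} {A A' : ℝ → ℝ} {M : ℝ} {p : Fin m → ℝ} {q b C' : ℝ}

/-- Remove measurability of `f`. -/
theorem ee_red_f (h : eeBMO A A' M) (hq : 1 ≤ q) (hp : ∀ j, 1 ≤ p j) (hC : 0 < C')
    (hcore : ∀ (a : Fin m → ℝ → ℝ) (f : ℝ → ℝ), (∀ j, Measurable (a j)) → Measurable f →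
        (∀ j, ∫⁻ y, ENNReal.ofReal (|a j y| ^ p j) ≠ ⊤) → eeBd m A A' p q b C' a f)
    (a : Fin m → ℝ → ℝ) (f : ℝ → ℝ) (ha : ∀ j, Measurable (a j)) : eeBd m A A' p q b C' a f := by
  by_cases hfin : ∀ j, ∫⁻ y, ENNReal.ofReal (|a j y| ^ p j) ≠ ⊤
  swap
  · push Not at hfin
    obtain ⟨j, hj⟩ := hfin
    unfold eeBd
    have : ∑ j : Fin m, ∫⁻ y, ENNReal.ofReal (|a j y| ^ p j) = ⊤ :=
      ENNReal.sum_eq_top.2 ⟨j, Finset.mem_univ j, hj⟩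
    rw [this, top_add, ENNReal.mul_top (by simpa using hC)]
    exact le_top
  have hla := (ee_cz m a ha p p hp (fun _ => le_rfl) hfin).1
  obtain ⟨S, hSm, hSf, hmax⟩ := ee_max_set f
  have hf2 : AEMeasurable (S.indicator f) volume := (aemeasurable_indicator_iff hSm).2 hSf
  have hb : eeBd m A A' p q b C' a (S.indicator f) :=
    ee_bd_congr m A A' p q b C' a a _ _ (fun _ => ae_eq_rfl) hf2.ae_eq_mk
      (hcore a _ ha hf2.measurable_mk hfin)
  refine le_trans ?_ (hb.trans ?_)
  · apply measure_mono
    intro x hx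
    have hx1 : 1 < |CcommA m A A' a f x| := hx
    have hall := ee_all_int x (fun y => eeK m A A' a x y * f y) (by
      intro h0
      rw [ee_CcommA_eq, h0] at hx1; simp at hx1; linarith)
    have hKm := h.K_meas m a hla x
    have e : CcommA m A A' a f x = CcommA m A A' a (S.indicator f) x := by
      rw [ee_CcommA_eq, ee_CcommA_eq]
      unfold limUnder
      congr 1
      apply Filter.map_congr
      filter_upwards [self_mem_nhdsWithin] with ε hε
      apply setIntegral_congr_ae (ee_trunc_meas x ε)
      set T := {y : ℝ | ε < |x - y|} ∩ {y | eeK m A A' a x y ≠ 0} with hT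
      have hTm : MeasurableSet T :=
        (ee_trunc_meas x ε).inter (hKm (measurableSet_singleton 0).compl)
      have hTf : AEMeasurable f (volume.restrict T) := by
        have h1 : AEMeasurable (fun y => eeK m A A' a x y * f y) (volume.restrict T) :=
          (hall ε hε).aestronglyMeasurable.aemeasurable.mono_measure
            (Measure.restrict_mono inter_subset_left le_rfl)
        refine (h1.div hKm.aemeasurable).congr ?_
        filter_upwards [ae_restrict_mem hTm] with y hy
        have : eeK m A A' a x y ≠ 0 := hy.2
        simp only [Pi.div_apply]
        field_simp
      have h0 : ∀ᵐ y, y ∉ T \ S := measure_eq_zero_iff_ae_notMem.1 (hmax T hTm hTf)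
      filter_upwards [h0] with y hy hyε
      by_cases hyS : y ∈ S
      · rw [indicator_of_mem hyS]
      · have : eeK m A A' a x y = 0 := by
          by_contra hc
          exact hy ⟨⟨hyε, hc⟩, hyS⟩
        rw [this, zero_mul, zero_mul]
    show 1 < |CcommA m A A' a (S.indicator f) x|
    rw [← e]; exact hx1
  · rw [ee_ind_Phi q b hq f S hSm]
    gcongr
    exact Measure.restrict_le_self

/-- The class of `x`. -/
def eeJ (a : Fin m → ℝ → ℝ) (x : ℝ) : Set ℝ := {y | ∀ j, IntervalIntegrable (a j) volume x y}

theorem eeJ_self (a : Fin m → ℝ → ℝ) (x : ℝ) : x ∈ eeJ a x := fun _ => IntervalIntegrable.refl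

theorem eeJ_eq (a : Fin m → ℝ → ℝ) {x y : ℝ} (h : y ∈ eeJ a x) : eeJ a x = eeJ a y := by
  ext z
  exact ⟨fun hz j => (h j).symm.trans (hz j), fun hz j => (h j).trans (hz j)⟩

theorem eeJ_ord (a : Fin m → ℝ → ℝ) (x : ℝ) : (eeJ a x).OrdConnected := by
  rw [ordConnected_iff_uIcc_subset]
  intro y hy z hz w hw j
  exact (hy j).trans (((hy j).symm.trans (hz j)).mono_set (uIcc_subset_uIcc_left hw))

theorem eeJ_aem (a : Fin m → ℝ → ℝ) (x : ℝ) (j : Fin m) :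
    AEMeasurable (a j) (volume.restrict (eeJ a x)) := by
  set J := eeJ a x with hJ
  have hord : J.OrdConnected := eeJ_ord a x
  set D : Set ℝ := (J ∩ range ((↑) : ℚ → ℝ)) ∪ ({y | IsGreatest J y} ∪ {y | IsLeast J y}) with hD
  have hDc : D.Countable := by
    refine ((countable_range _).mono inter_subset_right).union (Countable.union ?_ ?_)
    · exact Set.Subsingleton.countable fun y hy z hz => IsGreatest.unique hy hz
    · exact Set.Subsingleton.countable fun y hy z hz => IsLeast.unique hy hz
  have hDJ : D ⊆ J := by
    rintro y (hy | hy | hy)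
    · exact hy.1
    · exact hy.1
    · exact hy.1
  have : Countable D := hDc.to_subtype
  have hsub : J ⊆ {x} ∪ ⋃ s : D, uIcc x s := by
    intro y hy
    rcases lt_trichotomy x y with hxy | hxy | hxy
    · right
      by_cases hg : IsGreatest J y
      · exact mem_iUnion.2 ⟨⟨y, Or.inr (Or.inl hg)⟩, right_mem_uIcc⟩
      · have : ∃ z ∈ J, y < z := by
          by_contra hc
          push Not at hc
          exact hg ⟨hy, fun z hz => hc z hz⟩
        obtain ⟨z, hz, hyz⟩ := this
        obtain ⟨r, hr1, hr2⟩ := exists_rat_btwn hyz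
        refine mem_iUnion.2 ⟨⟨r, Or.inl ⟨hord.out hy hz ⟨hr1.le, hr2.le⟩, r, rfl⟩⟩, ?_⟩
        exact mem_uIcc.2 (Or.inl ⟨hxy.le, hr1.le⟩)
    · left; exact hxy.symm
    · right
      by_cases hg : IsLeast J y
      · exact mem_iUnion.2 ⟨⟨y, Or.inr (Or.inr hg)⟩, right_mem_uIcc⟩
      · have : ∃ z ∈ J, z < y := by
          by_contra hc
          push Not at hc
          exact hg ⟨hy, fun z hz => hc z hz⟩
        obtain ⟨z, hz, hyz⟩ := this
        obtain ⟨r, hr1, hr2⟩ := exists_rat_btwn hyz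
        refine mem_iUnion.2 ⟨⟨r, Or.inl ⟨hord.out hz hy ⟨hr1.le, hr2.le⟩, r, rfl⟩⟩, ?_⟩
        exact mem_uIcc.2 (Or.inr ⟨hr2.le, hxy.le⟩)
  refine AEMeasurable.mono_measure ?_ (Measure.restrict_mono hsub le_rfl)
  rw [aemeasurable_union_iff, aemeasurable_iUnion_iff]
  refine ⟨by simp [Measure.restrict_singleton], fun s => ?_⟩
  have := hDJ s.2 j
  rw [intervalIntegrable_iff'] at this
  exact this.aestronglyMeasurable.aemeasurable

theorem ee_J_C (a : Fin m → ℝ → ℝ) (f : ℝ → ℝ) (z x : ℝ) (hx : x ∈ eeJ a z) :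
    CcommA m A A' a f x =
      CcommA m A A' (fun j => (eeJ a z).indicator (a j)) ((eeJ a z).indicator f) x := by
  rw [ee_CcommA_eq, ee_CcommA_eq]
  congr 1; funext ε; congr 1; funext y
  have hord := ordConnected_iff_uIcc_subset.1 (eeJ_ord a z)
  by_cases hy : y ∈ eeJ a z
  · rw [indicator_of_mem hy]
    congr 1
    unfold eeK
    congr 2
    refine Finset.prod_congr rfl fun j _ => ?_
    apply intervalIntegral.integral_congr
    intro t ht
    simp only
    rw [indicator_of_mem (hord hy hx ht)]
  · rw [indicator_of_notMem hy, mul_zero]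
    rw [eeJ_eq a hx] at hy
    obtain ⟨j, hj⟩ := not_forall.1 hy
    have : Adiff (a j) x y = 0 := intervalIntegral.integral_undef fun h => hj h.symm
    have : eeK m A A' a x y = 0 := by
      unfold eeK
      rw [Finset.prod_eq_zero (Finset.mem_univ j) this, mul_zero, zero_div]
    rw [this, zero_mul]

theorem ee_red_a (hq : 1 ≤ q) (hp : ∀ j, 1 ≤ p j)
    (hcore : ∀ (a : Fin m → ℝ → ℝ) (f : ℝ → ℝ), (∀ j, AEMeasurable (a j)) →
      eeBd m A A' p q b C' a f)
    (a : Fin m → ℝ → ℝ) (f : ℝ → ℝ) : eeBd m A A' p q b C' a f := by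
  set 𝒥 : Set (Set ℝ) := range (fun r : ℚ => eeJ a (r : ℝ)) with h𝒥
  have h𝒥c : 𝒥.Countable := countable_range _
  have hm : ∀ J ∈ 𝒥, MeasurableSet J := by
    rintro _ ⟨r, rfl⟩; exact (eeJ_ord a r).measurableSet
  have hdisj : 𝒥.PairwiseDisjoint id := by
    rintro _ ⟨r, rfl⟩ _ ⟨s, rfl⟩ hne
    refine disjoint_left.2 fun t ht ht2 => hne ?_
    exact (eeJ_eq a ht).trans (eeJ_eq a ht2).symm
  have hincl : {x : ℝ | 1 < |CcommA m A A' a f x|} ⊆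
      ⋃ J ∈ 𝒥, {x : ℝ | 1 < |CcommA m A A' (fun j => J.indicator (a j)) (J.indicator f) x|} := by
    intro x hx
    have hx1 : 1 < |CcommA m A A' a f x| := hx
    have hex : ∃ y ∈ eeJ a x, y ≠ x := by
      by_contra hc
      push Not at hc
      have h0 : CcommA m A A' a f x = 0 := by
        rw [ee_CcommA_eq]
        have : (fun ε : ℝ => ∫ y in {y : ℝ | ε < |x - y|}, eeK m A A' a x y * f y) = fun _ => 0 := by
          funext ε
          rw [← integral_zero ℝ ℝ (μ := volume.restrict {y : ℝ | ε < |x - y|})]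
          congr 1; funext y
          by_cases hy : y = x
          · simp [eeK, hy]
          · have hy2 : y ∉ eeJ a x := fun h => hy (hc y h)
            obtain ⟨j, hj⟩ := not_forall.1 hy2
            have : Adiff (a j) x y = 0 := intervalIntegral.integral_undef fun h => hj h.symm
            have : eeK m A A' a x y = 0 := by
              unfold eeK
              rw [Finset.prod_eq_zero (Finset.mem_univ j) this, mul_zero, zero_div]
            rw [this, zero_mul]
        rw [this]
        exact tendsto_const_nhds.limUnder_eq
      rw [h0, abs_zero] at hx1
      linarith
    obtain ⟨y, hy, hyx⟩ := hex
    have hr : ∃ r : ℚ, (r : ℝ) ∈ eeJ a x := by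
      have hord := (eeJ_ord a x).out
      rcases lt_or_gt_of_ne hyx with h | h
      · obtain ⟨r, h1, h2⟩ := exists_rat_btwn h
        exact ⟨r, hord hy (eeJ_self a x) ⟨h1.le, h2.le⟩⟩
      · obtain ⟨r, h1, h2⟩ := exists_rat_btwn h
        exact ⟨r, hord (eeJ_self a x) hy ⟨h1.le, h2.le⟩⟩
    obtain ⟨r, hr⟩ := hr
    have hJ := eeJ_eq a hr
    have hxr : x ∈ eeJ a r := hJ ▸ eeJ_self a x
    refine mem_biUnion (x := eeJ a r) ⟨r, rfl⟩ ?_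
    show 1 < |CcommA m A A' (fun j => (eeJ a r).indicator (a j)) ((eeJ a r).indicator f) x|
    rw [← ee_J_C a f r x hxr]
    exact hx1
  unfold eeBd
  set ψ : ℝ → ℝ≥0∞ := fun y => ENNReal.ofReal (|f y| ^ q * Real.log (Real.exp 1 + |f y|) ^ b) with hψ
  have hsum : ∀ φ : ℝ → ℝ≥0∞, ∑' J : 𝒥, ∫⁻ y in (J : Set ℝ), φ y ≤ ∫⁻ y, φ y := by
    intro φ
    have := lintegral_biUnion (μ := volume) h𝒥c (s := id) hm hdisj φ
    simp only [id] at this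
    rw [← this]
    exact setLIntegral_le_lintegral _ _
  calc volume {x : ℝ | 1 < |CcommA m A A' a f x|}
      ≤ ∑' J : 𝒥, volume {x : ℝ | 1 < |CcommA m A A' (fun j => (J : Set ℝ).indicator (a j))
          ((J : Set ℝ).indicator f) x|} := (measure_mono hincl).trans (measure_biUnion_le _ h𝒥c _)
    _ ≤ ∑' J : 𝒥, ENNReal.ofReal C' * ((∑ j : Fin m, ∫⁻ y in (J : Set ℝ), ENNReal.ofReal (|a j y| ^ p j)) +
          ∫⁻ y in (J : Set ℝ), ψ y) := by
        apply ENNReal.tsum_le_tsum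
        intro J
        have h1 := hcore (fun j => (J : Set ℝ).indicator (a j)) ((J : Set ℝ).indicator f) (by
          intro j
          obtain ⟨r, hr⟩ := J.2
          rw [aemeasurable_indicator_iff (hm _ J.2), ← hr]
          exact eeJ_aem a r j)
        unfold eeBd at h1
        rw [ee_ind_Phi q b hq f _ (hm _ J.2)] at h1
        simp_rw [ee_ind_p _ (hp _) _ _ (hm _ J.2)] at h1
        exact h1
    _ = ENNReal.ofReal C' * ((∑ j : Fin m, ∑' J : 𝒥, ∫⁻ y in (J : Set ℝ), ENNReal.ofReal (|a j y| ^ p j)) +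
          ∑' J : 𝒥, ∫⁻ y in (J : Set ℝ), ψ y) := by
        rw [ENNReal.tsum_mul_left, ENNReal.tsum_add,
          Summable.tsum_finsetSum fun _ _ => ENNReal.summable]
    _ ≤ _ := by
        gcongr
        · exact hsum _
        · exact hsum _

end red

theorem ee_main (m : ℕ) (A A' : ℝ → ℝ)
    (hA : ∀ x, HasDerivAt A (A' x) x) (hbmo : MemBMO A')
    (q : Fin (m + 1) → ℝ) (hq : ∀ i, 1 ≤ q i) (β : ℝ) (hβ : 0 ≤ β) (C : ℝ)
    (hyp : ∀ (a : Fin m → ℝ → ℝ) (f : ℝ → ℝ),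
      volume {x : ℝ | 1 < |CcommA m A A' a f x|} ≤
        ENNReal.ofReal C *
          ((∑ j : Fin m, ∫⁻ y, ENNReal.ofReal (|a j y| ^ q j.castSucc)) +
            ∫⁻ y, ENNReal.ofReal
              (|f y| ^ q (Fin.last m) * Real.log (Real.exp 1 + |f y|) ^ β)))
    (p : Fin m → ℝ) (hp : ∀ j, 1 ≤ p j ∧ p j < q j.castSucc)
    (b : ℝ) (hβb : β ≤ b) (hqb : q (Fin.last m) = 1 → 1 ≤ b) :
    ∃ C' : ℝ, 0 < C' ∧ ∀ (a : Fin m → ℝ → ℝ) (f : ℝ → ℝ), eeBd m A A' p (q (Fin.last m)) b C' a f := by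
  obtain ⟨M, h⟩ := eeBMO_of hA hbmo
  obtain ⟨C', hC', hcore⟩ := ee_core m A A' M h q hq β hβ C hyp p hp b hβb hqb
  refine ⟨C', hC', ?_⟩
  apply ee_red_a (hq _) (fun j => (hp j).1)
  intro a f ha
  exact ee_bd_congr _ _ _ _ _ _ _ a _ f f (fun j => (ha j).ae_eq_mk) ae_eq_rfl
    (ee_red_f h (hq _) (fun j => (hp j).1) hC' hcore _ f (fun j => (ha j).measurable_mk))

/-- Lemma 2.7: extrapolation of weak type endpoint estimates for the
generalized Calderón commutator, lowering the exponents of the `a_j` entries. -/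
theorem extrapolation_endpoint_CcommA (m : ℕ) (A A' : ℝ → ℝ)
    (hA : ∀ x, HasDerivAt A (A' x) x) (hbmo : MemBMO A')
    (q : Fin (m + 1) → ℝ) (hq : ∀ i, 1 ≤ q i) (β : ℝ) (hβ : 0 ≤ β) (C : ℝ)
    (hyp : ∀ (a : Fin m → ℝ → ℝ) (f : ℝ → ℝ),
      volume {x : ℝ | 1 < |CcommA m A A' a f x|} ≤
        ENNReal.ofReal C *
          ((∑ j : Fin m, ∫⁻ y, ENNReal.ofReal (|a j y| ^ q j.castSucc)) +
            ∫⁻ y, ENNReal.ofReal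
              (|f y| ^ q (Fin.last m) * Real.log (Real.exp 1 + |f y|) ^ β)))
    (p : Fin m → ℝ) (hp : ∀ j, 1 ≤ p j ∧ p j < q j.castSucc) :
    ∃ C' : ℝ, 0 < C' ∧
      ∀ (a : Fin m → ℝ → ℝ) (f : ℝ → ℝ),
        volume {x : ℝ | 1 < |CcommA m A A' a f x|} ≤
          ENNReal.ofReal C' *
            ((∑ j : Fin m, ∫⁻ y, ENNReal.ofReal (|a j y| ^ p j)) +
              ∫⁻ y, ENNReal.ofReal
                (|f y| ^ q (Fin.last m) * Real.log (Real.exp 1 + |f y|) ^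
                  (if q (Fin.last m) = 1 then max 1 β else β))) := by
  refine ee_main m A A' hA hbmo q hq β hβ C hyp p hp _ ?_ ?_
  · split_ifs
    · exact le_max_right _ _
    · exact le_rfl
  · intro h1
    rw [if_pos h1]
    exact le_max_left _ _
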